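/- arXiv:2405.17415 — 3 statements merged into one kernel-verified Lean document; each statement's English description precedes it below -/
import Mathlib

section
/- Let D be a germ of k-dimensional singular holomorphic distribution at 0 ∈ ℂ^n with locally free tangent sheaf, defined by a germ of holomorphic (n−k)-form ω with codim(sing(ω)) ≥ 2. Let X be a germ of holomorphic vector field at 0 with X(0) = 0, tangent to D (i_X ω = 0), and with linear rank at least k. Then exactly one of the following holds: (1) there exist germs of holomorphic vector fields Y_1, …, Y_{k−1} and a germ of holomorphic n-form Θ at 0 such that ω = i_X i_{Y_1} ⋯ i_{Y_{k−1}} Θ, and this case occurs if and only if sing(X) ⊆ sing(D); (2) the germ of distribution D is regular (ω(0) ≠ 0), and in this case the linear rank of X equals exactly k. -/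
open Topology Filter Set
open scoped ENNReal Manifold

noncomputable section

/-- `ℂⁿ`. -/
abbrev Cn (n : ℕ) : Type := Fin n → ℂ

/-- Holomorphic `m`-forms on (open subsets of) `ℂⁿ`, as alternating-map valued functions. -/
abbrev Form (n m : ℕ) : Type := Cn n → AlternatingMap ℂ (Cn n) ℂ (Fin m)

/-- Vector fields on (open subsets of) `ℂⁿ`. -/
abbrev VF (n : ℕ) : Type := Cn n → Cn n

/-- A form is holomorphic on `U` if all its coefficient functions are. -/
def HolFormOn {n m : ℕ} (U : Set (Cn n)) (ω : Form n m) : Prop :=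
  ∀ v : Fin m → Cn n, AnalyticOnNhd ℂ (fun z => ω z v) U

/-- A form is holomorphic at (a neighborhood of) a point `c`. -/
def HolFormAt {n m : ℕ} (c : Cn n) (ω : Form n m) : Prop :=
  ∀ v : Fin m → Cn n, AnalyticAt ℂ (fun z => ω z v) c

/-- The zero locus (singular set) of a form. -/
def zeroLocus {n m : ℕ} (ω : Form n m) : Set (Cn n) := {z | ω z = 0}

/-- `V ⊆ ℂⁿ` has (complex) codimension at least `c`; via Hausdorff dimension
(a complex-analytic set of complex dimension `d` has Hausdorff dimension `2d`).
The empty set has codimension `≥ c` for every `c`. -/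
def CodimGE (n : ℕ) (V : Set (Cn n)) (c : ℕ) : Prop :=
  V = ∅ ∨ dimH V + 2 * (c : ℝ≥0∞) ≤ 2 * (n : ℝ≥0∞)

/-- The germ of `V` at `c` has codimension at least `k`. -/
def GermCodimGE (n : ℕ) (c : Cn n) (V : Set (Cn n)) (k : ℕ) : Prop :=
  ∃ U ∈ 𝓝 c, CodimGE n (V ∩ U) k

/-- `i_X (ω) = 0` at the point `z` : the form `ω` annihilates the vector `X z` at `z`. -/
def TangentAt {n m : ℕ} (ω : Form n m) (X : VF n) (z : Cn n) : Prop :=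
  ∀ (v : Fin m → Cn n) (i : Fin m), v i = X z → ω z v = 0

/-- `ω` is locally decomposable (as a wedge of holomorphic `1`-forms) at the points
of `U` where it does not vanish. -/
def LocallyDecomp {n m : ℕ} (U : Set (Cn n)) (ω : Form n m) : Prop :=
  ∀ z ∈ U, ω z ≠ 0 → ∃ W ∈ 𝓝 z, W ⊆ U ∧ ∃ η : Fin m → Cn n → (Cn n →ₗ[ℂ] ℂ),
    (∀ i (v : Cn n), AnalyticOnNhd ℂ (fun w => η i w v) W) ∧
    ∀ w ∈ W, ∀ v : Fin m → Cn n, ω w v = Matrix.det (Matrix.of fun i j => η i w (v j))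

/-- The rank of the derivative (linear part) of a vector field at a point. -/
def rkAt {n : ℕ} (X : VF n) (z : Cn n) : ℕ :=
  Module.finrank ℂ (LinearMap.range (fderiv ℂ X z).toLinearMap)

/-- The germ at `c` of the vector field `X` divides the germ of the `m`-form `ω`:
`ω = i_X Θ` for some germ of holomorphic `(m+1)`-form `Θ`. -/
def DividesAt {n m : ℕ} (X : VF n) (ω : Form n m) (c : Cn n) : Prop :=
  ∃ Θ : Form n (m + 1), HolFormAt c Θ ∧
    ∀ᶠ z in 𝓝 c, ∀ v : Fin m → Cn n, ω z v = Θ z (Fin.cons (X z) v)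

/-- The germ at `0` of an `m`-form defines a singular holomorphic distribution:
it is holomorphic, locally decomposable outside its zero set, and its zero set has
codimension at least two. -/
structure IsGermDist (n m : ℕ) (ω : Form n m) : Prop where
  hol : ∃ U ∈ 𝓝 (0 : Cn n), HolFormOn U ω ∧ LocallyDecomp U ω
  codim : GermCodimGE n 0 (zeroLocus ω) 2

/-- The tangent sheaf of the germ of two-dimensional distribution defined by the
`m`-form `ω` (`m = n - 2`) is locally free: `ω = i_Y i_Z Θ` for germs of vector fields
`Y, Z` and a germ of `n`-form `Θ`. -/
def GermLocFree2 (n m : ℕ) (ω : Form n m) : Prop :=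
  ∃ (Y Z : VF n) (Θ : Form n (m + 2)), AnalyticAt ℂ Y 0 ∧ AnalyticAt ℂ Z 0 ∧ HolFormAt 0 Θ ∧
    ∀ᶠ z in 𝓝 (0 : Cn n), ∀ v : Fin m → Cn n,
      ω z v = Θ z (Fin.cons (Y z) (Fin.cons (Z z) v))

/-- `ω = i_X i_Y Θ` near `0`, for some germ of vector field `Y` and germ of `n`-form `Θ`. -/
def DivPairAt {n m : ℕ} (X : VF n) (ω : Form n m) : Prop :=
  ∃ (Y : VF n) (Θ : Form n (m + 2)), AnalyticAt ℂ Y 0 ∧ HolFormAt 0 Θ ∧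
    ∀ᶠ z in 𝓝 (0 : Cn n), ∀ v : Fin m → Cn n,
      ω z v = Θ z (Fin.cons (X z) (Fin.cons (Y z) v))

/-- The tangent sheaf of the germ of `k`-dimensional distribution defined by the `m`-form
`ω` (`n = k + m`) is locally free: `ω = i_{X_1} ⋯ i_{X_k} Θ`. -/
def GermLocFreeK (n k m : ℕ) (h : n = k + m) (ω : Form n m) : Prop :=
  ∃ (Xs : Fin k → VF n) (Θ : Form n n), (∀ i, AnalyticAt ℂ (Xs i) 0) ∧ HolFormAt 0 Θ ∧
    ∀ᶠ z in 𝓝 (0 : Cn n), ∀ v : Fin m → Cn n,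
      ω z v = Θ z (fun i => Fin.append (fun a => Xs a z) v (Fin.cast h i))

/-- The germs at `c` of the vector fields `Xs` freely generate the germs of vector
fields tangent to the distribution defined by `ω` : every germ of tangent vector field
is a combination of the `Xs` with holomorphic coefficients, and the coefficients in such
combinations are unique (i.e. the `Xs` are independent over the local ring at `c`). -/
def FreeGensAt {n m : ℕ} (ω : Form n m) {k : ℕ} (Xs : Fin k → VF n) (c : Cn n) : Prop :=
  (∀ Z : VF n, AnalyticAt ℂ Z c → (∀ᶠ z in 𝓝 c, TangentAt ω Z z) →
      ∃ f : Fin k → Cn n → ℂ, (∀ i, AnalyticAt ℂ (f i) c) ∧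
        ∀ᶠ z in 𝓝 c, Z z = ∑ i, f i z • Xs i z) ∧
  (∀ f : Fin k → Cn n → ℂ, (∀ i, AnalyticAt ℂ (f i) c) →
      (∀ᶠ z in 𝓝 c, (∑ i, f i z • Xs i z) = 0) → ∀ i, ∀ᶠ z in 𝓝 c, f i z = 0)

/-- Polydiscs in `ℂⁿ`. -/
def IsPolydisc {n : ℕ} (U : Set (Cn n)) : Prop :=
  ∃ (c : Cn n) (r : Fin n → ℝ), (∀ i, 0 < r i) ∧ U = {z | ∀ i, dist (z i) (c i) < r i}

/-- The wedge product of a `1`-form with a `k`-form, as a function of `k+1` vectors. -/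
def wedge1 {n k : ℕ} (ω : Form n 1) (α : Form n k) (z : Cn n) (v : Fin (k + 1) → Cn n) : ℂ :=
  ∑ i : Fin (k + 1), (-1 : ℂ) ^ (i : ℕ) * ω z (fun _ => v i) * α z (fun j => v (i.succAbove j))

/-! ### Analytic subsets of open sets of `ℂᴺ`, irreducibility, components -/

/-- `V` is an analytic subset of `U`: locally (on `U`) it is the common zero set of
finitely many holomorphic functions. -/
def IsAnalyticIn {N : ℕ} (U V : Set (Cn N)) : Prop :=
  V ⊆ U ∧ ∀ p ∈ U, ∃ W ∈ 𝓝 p, ∃ (r : ℕ) (f : Fin r → Cn N → ℂ),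
    (∀ i, AnalyticOnNhd ℂ (f i) W) ∧ ∀ z ∈ W ∩ U, (z ∈ V ↔ ∀ i, f i z = 0)

/-- An irreducible analytic subset of `U`. -/
def IsIrredAnalyticIn {N : ℕ} (U V : Set (Cn N)) : Prop :=
  IsAnalyticIn U V ∧ V.Nonempty ∧
    ∀ V1 V2, IsAnalyticIn U V1 → IsAnalyticIn U V2 → V = V1 ∪ V2 → V = V1 ∨ V = V2

/-- `C` is an irreducible component of the analytic set `V ⊆ U` : a maximal irreducible
analytic subset of `U` contained in `V`. -/
def IsIrredComponentIn {N : ℕ} (U V C : Set (Cn N)) : Prop :=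
  IsIrredAnalyticIn U C ∧ C ⊆ V ∧ ∀ C', IsIrredAnalyticIn U C' → C ⊆ C' → C' ⊆ V → C' = C

/-! ### Distributions and foliations on `ℙⁿ`, in homogeneous coordinates -/

/-- A `k`-dimensional singular holomorphic distribution of degree `d` on `ℙⁿ`, given in
homogeneous coordinates by a homogeneous `(n-k)`-form `ω` on `ℂⁿ⁺¹` (with polynomial
coefficients of degree `d+1`) satisfying `i_R ω = 0`, locally decomposable outside its
singular set, whose singular set has codimension at least `2`. -/
structure ProjDist (n k : ℕ) where
  d : ℕ
  ω : Form (n + 1) (n - k)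
  hol : HolFormOn Set.univ ω
  homog : ∀ (t : ℂ) (z : Cn (n + 1)) (v : Fin (n - k) → Cn (n + 1)),
    ω (t • z) v = t ^ (d + 1) * ω z v
  radial : ∀ (z : Cn (n + 1)) (v : Fin (n - k) → Cn (n + 1)) (i : Fin (n - k)),
    v i = z → ω z v = 0
  decomp : LocallyDecomp Set.univ ω
  codim : CodimGE (n + 1) {z | z ≠ 0 ∧ ω z = 0} 2

/-- The singular set of a distribution on `ℙⁿ`, as a cone in `ℂⁿ⁺¹ \ {0}`. -/
def ProjDist.coneSing {n k : ℕ} (D : ProjDist n k) : Set (Cn (n + 1)) :=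
  {z | z ≠ 0 ∧ D.ω z = 0}

/-- A one-dimensional singular holomorphic foliation of degree `d` on `ℙⁿ`, given in
homogeneous coordinates by a homogeneous polynomial vector field on `ℂⁿ⁺¹`, whose
singular set (points where `V ∧ R = 0`) has codimension at least `2`. -/
structure ProjFol1 (n : ℕ) where
  d : ℕ
  V : VF (n + 1)
  hol : AnalyticOnNhd ℂ V Set.univ
  homog : ∀ (t : ℂ) (z : Cn (n + 1)), V (t • z) = t ^ d • V z
  codim : CodimGE (n + 1) {z | z ≠ 0 ∧ V z ∈ Submodule.span ℂ {z}} 2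

/-- The singular set of a one-dimensional foliation on `ℙⁿ`, as a cone in `ℂⁿ⁺¹ \ {0}`. -/
def ProjFol1.coneSing {n : ℕ} (G : ProjFol1 n) : Set (Cn (n + 1)) :=
  {z | z ≠ 0 ∧ G.V z ∈ Submodule.span ℂ {z}}

/-- The foliation `G` is tangent to the distribution `D` : `i_V ω = 0`. -/
def PTangent {n k : ℕ} (G : ProjFol1 n) (D : ProjDist n k) : Prop :=
  ∀ (z : Cn (n + 1)) (v : Fin (n - k) → Cn (n + 1)) (i : Fin (n - k)),
    v i = G.V z → D.ω z v = 0

/-- `G` locally divides the two-dimensional distribution `D` at the point of `ℙⁿ`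
corresponding to `q ∈ ℂⁿ⁺¹ \ {0}` : in homogeneous coordinates, `ω = i_V i_R Θ` near `q`
for some germ of holomorphic `(n-1)`-form `Θ` (equivalently, in an affine chart at `[q]`,
the defining vector field of `G` divides the defining form of `D`). -/
def PLocDividesAt {n : ℕ} (G : ProjFol1 n) (D : ProjDist n 2) (q : Cn (n + 1)) : Prop :=
  ∃ Θ : Form (n + 1) (n - 2 + 2), HolFormAt q Θ ∧
    ∀ᶠ z in 𝓝 q, ∀ v : Fin (n - 2) → Cn (n + 1),
      D.ω z v = Θ z (Fin.cons (G.V z) (Fin.cons z v))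

/-- The tangent sheaf of the two-dimensional distribution `D` on `ℙⁿ` is locally free:
near every point of `ℂⁿ⁺¹ \ {0}` one can write `ω = i_X i_Y i_R Θ`. -/
def PLocFreeAt {n : ℕ} (D : ProjDist n 2) (q : Cn (n + 1)) : Prop :=
  ∃ (X Y : VF (n + 1)) (Θ : Form (n + 1) (n - 2 + 3)),
    AnalyticAt ℂ X q ∧ AnalyticAt ℂ Y q ∧ HolFormAt q Θ ∧
    ∀ᶠ z in 𝓝 q, ∀ v : Fin (n - 2) → Cn (n + 1),
      D.ω z v = Θ z (Fin.cons (X z) (Fin.cons (Y z) (Fin.cons z v)))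

def PLocFree {n : ℕ} (D : ProjDist n 2) : Prop :=
  ∀ q : Cn (n + 1), q ≠ 0 → PLocFreeAt D q

/-- The linearization, at a singular point `q` (with `ℓ q = 1`), of the vector field
induced on the affine chart `{ℓ = 1}` of `ℙⁿ` by the homogeneous vector field `V`. -/
def projLin {n : ℕ} (V : VF n) (q : Cn n) (ℓ : Cn n →ₗ[ℂ] ℂ) : Cn n →ₗ[ℂ] Cn n :=
  (fderiv ℂ V q).toLinearMap - LinearMap.smulRight (ℓ ∘ₗ (fderiv ℂ V q).toLinearMap) q
    - ℓ (V q) • LinearMap.id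

/-- The linear rank of the one-dimensional foliation `G` on `ℙⁿ` is at least `r` :
at every singular point, the linearization of the vector field induced on an affine
chart has rank at least `r`. -/
def PLinRankGE {n : ℕ} (G : ProjFol1 n) (r : ℕ) : Prop :=
  ∀ q ∈ G.coneSing, ∃ ℓ : Cn (n + 1) →ₗ[ℂ] ℂ, ℓ q = 1 ∧
    r ≤ Module.finrank ℂ (Submodule.map (projLin G.V q ℓ) (LinearMap.ker ℓ))

/-- `T_D = T_G ⊕ T_H` : in homogeneous coordinates,
`ω = c ⋅ i_{V_G} i_{V_H} i_R (dx_0 ∧ ⋯ ∧ dx_n)` for a nonzero constant `c`. -/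
def SplitPair {n : ℕ} (hn : n + 1 = 3 + (n - 2)) (G H : ProjFol1 n) (D : ProjDist n 2) :
    Prop :=
  ∃ c : ℂ, c ≠ 0 ∧ ∀ (z : Cn (n + 1)) (v : Fin (n - 2) → Cn (n + 1)),
    D.ω z v = c * Matrix.det (Matrix.of fun i j =>
      Fin.append ![G.V z, H.V z, z] v (Fin.cast hn i) j)

/-- The tangent sheaf of the two-dimensional distribution `D` on `ℙⁿ` splits as a direct
sum of two line bundles: `ω = c ⋅ i_{X_1} i_{X_2} i_R (dx_0 ∧ ⋯ ∧ dx_n)` for homogeneous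
polynomial vector fields `X_1, X_2` on `ℂⁿ⁺¹`. -/
def PSplits {n : ℕ} (hn : n + 1 = 3 + (n - 2)) (D : ProjDist n 2) : Prop :=
  ∃ (X1 X2 : VF (n + 1)) (d1 d2 : ℕ) (c : ℂ), c ≠ 0 ∧
    AnalyticOnNhd ℂ X1 Set.univ ∧ AnalyticOnNhd ℂ X2 Set.univ ∧
    (∀ (t : ℂ) (z : Cn (n + 1)), X1 (t • z) = t ^ d1 • X1 z) ∧
    (∀ (t : ℂ) (z : Cn (n + 1)), X2 (t • z) = t ^ d2 • X2 z) ∧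
    ∀ (z : Cn (n + 1)) (v : Fin (n - 2) → Cn (n + 1)),
      D.ω z v = c * Matrix.det (Matrix.of fun i j =>
        Fin.append ![X1 z, X2 z, z] v (Fin.cast hn i) j)

/-- The coefficient of the exterior differential of a `1`-form: `dω(a,b)` at `z`. -/
def extd1 {N : ℕ} (ω : Form N 1) (z a b : Cn N) : ℂ :=
  fderiv ℂ (fun y => ω y ![b]) z a - fderiv ℂ (fun y => ω y ![a]) z b

/-- The Frobenius integrability condition `ω ∧ dω = 0` for a `1`-form. -/
def Integrable1 {N : ℕ} (ω : Form N 1) : Prop :=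
  ∀ z a b c : Cn N,
    ω z ![a] * extd1 ω z b c + ω z ![b] * extd1 ω z c a + ω z ![c] * extd1 ω z a b = 0

/-! ### Distributions and foliations on complex manifolds -/

section Manifold

variable {n k : ℕ} {M : Type*} [TopologicalSpace M] [ChartedSpace (Cn n) M]

/-- A `k`-dimensional singular holomorphic distribution on a complex `n`-manifold `M`:
around each point it is given, in the chart at that point, by a holomorphic `(n-k)`-form,
locally decomposable outside its zero set, with zero set of codimension at least 2;
on overlaps the local forms agree up to a nonvanishing holomorphic factor. -/
structure MDist (n k : ℕ) (M : Type*) [TopologicalSpace M] [ChartedSpace (Cn n) M] where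
  ω : M → Form n (n - k)
  dom : M → Set (Cn n)
  dom_open : ∀ p, IsOpen (dom p)
  dom_sub : ∀ p, dom p ⊆ (chartAt (Cn n) p).target
  dom_mem : ∀ p, chartAt (Cn n) p p ∈ dom p
  hol : ∀ p, HolFormOn (dom p) (ω p)
  decomp : ∀ p, LocallyDecomp (dom p) (ω p)
  codim : ∀ p, CodimGE n (zeroLocus (ω p) ∩ dom p) 2
  compat : ∀ p q : M, ∀ x : M, x ∈ (chartAt (Cn n) p).source → x ∈ (chartAt (Cn n) q).source →
    chartAt (Cn n) p x ∈ dom p → chartAt (Cn n) q x ∈ dom q →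
    ∃ W ∈ 𝓝 (chartAt (Cn n) p x), W ⊆ dom p ∧
      ∃ h : Cn n → ℂ, AnalyticOnNhd ℂ h W ∧ (∀ z ∈ W, h z ≠ 0) ∧
      ∀ z ∈ W, ∀ v : Fin (n - k) → Cn n,
        ω p z v = h z * ω q ((chartAt (Cn n) q) ((chartAt (Cn n) p).symm z))
          (fun i => fderiv ℂ (fun y => (chartAt (Cn n) q) ((chartAt (Cn n) p).symm y)) z (v i))

/-- The singular set of a distribution on a manifold. -/
def MDist.sing (D : MDist n k M) : Set M :=
  {x | D.ω x (chartAt (Cn n) x x) = 0}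

/-- A one-dimensional singular holomorphic foliation on a complex `n`-manifold `M`:
around each point it is given, in the chart at that point, by a holomorphic vector field
with singular set of codimension at least 2; on overlaps the local vector fields agree,
up to a nonvanishing holomorphic factor, under the differentials of the transition maps. -/
structure MFol1 (n : ℕ) (M : Type*) [TopologicalSpace M] [ChartedSpace (Cn n) M] where
  V : M → VF n
  dom : M → Set (Cn n)
  dom_open : ∀ p, IsOpen (dom p)
  dom_sub : ∀ p, dom p ⊆ (chartAt (Cn n) p).target
  dom_mem : ∀ p, chartAt (Cn n) p p ∈ dom p
  hol : ∀ p, AnalyticOnNhd ℂ (V p) (dom p)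
  codim : ∀ p, CodimGE n ({z ∈ dom p | V p z = 0}) 2
  compat : ∀ p q : M, ∀ x : M, x ∈ (chartAt (Cn n) p).source → x ∈ (chartAt (Cn n) q).source →
    chartAt (Cn n) p x ∈ dom p → chartAt (Cn n) q x ∈ dom q →
    ∃ W ∈ 𝓝 (chartAt (Cn n) p x), W ⊆ dom p ∧
      ∃ h : Cn n → ℂ, AnalyticOnNhd ℂ h W ∧ (∀ z ∈ W, h z ≠ 0) ∧
      ∀ z ∈ W,
        fderiv ℂ (fun y => (chartAt (Cn n) q) ((chartAt (Cn n) p).symm y)) z (V p z)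
          = h z • V q ((chartAt (Cn n) q) ((chartAt (Cn n) p).symm z))

/-- The singular set of a one-dimensional foliation on a manifold. -/
def MFol1.sing (G : MFol1 n M) : Set M :=
  {x | G.V x (chartAt (Cn n) x x) = 0}

/-- The foliation `G` is tangent to the distribution `D`. -/
def MTangent (G : MFol1 n M) (D : MDist n k M) : Prop :=
  ∀ p : M, ∀ z ∈ G.dom p ∩ D.dom p, TangentAt (D.ω p) (G.V p) z

/-- `G` locally divides `D` at `p` : in the chart at `p`, the germ of the defining vector
field of `G` divides the germ of the defining form of `D`. -/
def MLocDividesAt (G : MFol1 n M) (D : MDist n k M) (p : M) : Prop :=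
  DividesAt (G.V p) (D.ω p) (chartAt (Cn n) p p)

/-- The linear rank of `G` is at least `r`: at every singular point `p`, the rank of the
derivative at (the chart image of) `p` of the defining vector field is at least `r`. -/
def MLinRankGE (G : MFol1 n M) (r : ℕ) : Prop :=
  ∀ p ∈ MFol1.sing G, r ≤ rkAt (G.V p) (chartAt (Cn n) p p)

/-- The stalk of the tangent sheaf of `D` at `p` is a free module with `r` generators. -/
def MStalkFreeWith (D : MDist n k M) (p : M) (r : ℕ) : Prop :=
  ∃ Xs : Fin r → VF n, (∀ i, AnalyticAt ℂ (Xs i) (chartAt (Cn n) p p)) ∧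
    (∀ i, ∀ᶠ z in 𝓝 (chartAt (Cn n) p p), TangentAt (D.ω p) (Xs i) z) ∧
    FreeGensAt (D.ω p) Xs (chartAt (Cn n) p p)

/-- (a) The tangent sheaf of `D` is locally free of rank `k`: near every point there are
`k` holomorphic tangent vector fields which freely generate every stalk. -/
def MPropA (D : MDist n k M) : Prop :=
  ∀ p : M, ∃ U : Set (Cn n), IsOpen U ∧ chartAt (Cn n) p p ∈ U ∧ U ⊆ D.dom p ∧
    ∃ Xs : Fin k → VF n, (∀ i, AnalyticOnNhd ℂ (Xs i) U) ∧
      (∀ i, ∀ z ∈ U, TangentAt (D.ω p) (Xs i) z) ∧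
      ∀ z ∈ U, FreeGensAt (D.ω p) Xs z

/-- (b) Near every point, `T_D` is the direct sum of the tangent sheaves of `k`
one-dimensional foliations (defined by vector fields with singular set of codim `≥ 2`). -/
def MPropB (D : MDist n k M) : Prop :=
  ∀ p : M, ∃ U : Set (Cn n), IsOpen U ∧ chartAt (Cn n) p p ∈ U ∧ U ⊆ D.dom p ∧
    ∃ Xs : Fin k → VF n, (∀ i, AnalyticOnNhd ℂ (Xs i) U) ∧
      (∀ i, CodimGE n {z ∈ U | Xs i z = 0} 2) ∧
      (∀ i, ∀ z ∈ U, TangentAt (D.ω p) (Xs i) z) ∧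
      ∀ z ∈ U, FreeGensAt (D.ω p) Xs z

/-- (c) Near every point, a form `i_{X_1} ⋯ i_{X_k} Θ` defines `D`. -/
def MPropC (h : n = k + (n - k)) (D : MDist n k M) : Prop :=
  ∀ p : M, ∃ U : Set (Cn n), IsOpen U ∧ chartAt (Cn n) p p ∈ U ∧ U ⊆ D.dom p ∧
    ∃ (Xs : Fin k → VF n) (Θ : Form n n) (u : Cn n → ℂ),
      (∀ i, AnalyticOnNhd ℂ (Xs i) U) ∧ HolFormOn U Θ ∧
      AnalyticOnNhd ℂ u U ∧ (∀ z ∈ U, u z ≠ 0) ∧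
      ∀ z ∈ U, ∀ v : Fin (n - k) → Cn n,
        D.ω p z v = u z * Θ z (fun i => Fin.append (fun a => Xs a z) v (Fin.cast h i))

/-- (d) At every point, a form `i_{X_1} ⋯ i_{X_k} Θ` defines the germ of `D`. -/
def MPropD (h : n = k + (n - k)) (D : MDist n k M) : Prop :=
  ∀ p : M, ∃ (Xs : Fin k → VF n) (Θ : Form n n) (u : Cn n → ℂ),
    (∀ i, AnalyticAt ℂ (Xs i) (chartAt (Cn n) p p)) ∧ HolFormAt (chartAt (Cn n) p p) Θ ∧
    AnalyticAt ℂ u (chartAt (Cn n) p p) ∧ u (chartAt (Cn n) p p) ≠ 0 ∧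
    ∀ᶠ z in 𝓝 (chartAt (Cn n) p p), ∀ v : Fin (n - k) → Cn n,
      D.ω p z v = u z * Θ z (fun i => Fin.append (fun a => Xs a z) v (Fin.cast h i))

/-- (e) Every stalk of `T_D` is a free module with `k` generators. -/
def MPropE (D : MDist n k M) : Prop :=
  ∀ p : M, MStalkFreeWith D p k

/-- A subset `S` of the complex manifold `M` is analytic: it is closed and locally,
in charts, the common zero set of finitely many holomorphic functions. -/
def MIsAnalytic (n : ℕ) {M : Type*} [TopologicalSpace M] [ChartedSpace (Cn n) M] (S : Set M) : Prop :=
  IsClosed S ∧ ∀ p : M, ∃ W ∈ 𝓝 (chartAt (Cn n) p p), ∃ (r : ℕ) (f : Fin r → Cn n → ℂ),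
    (∀ i, AnalyticOnNhd ℂ (f i) W) ∧
    ∀ z ∈ W ∩ (chartAt (Cn n) p).target, ((chartAt (Cn n) p).symm z ∈ S ↔ ∀ i, f i z = 0)

/-- Irreducible analytic subsets of `M`. -/
def MIrredAnalytic (n : ℕ) {M : Type*} [TopologicalSpace M] [ChartedSpace (Cn n) M] (S : Set M) : Prop :=
  MIsAnalytic n S ∧ S.Nonempty ∧
    ∀ S1 S2 : Set M, MIsAnalytic n S1 → MIsAnalytic n S2 → S = S1 ∪ S2 → S = S1 ∨ S = S2

/-- `C` is an irreducible component of `V ⊆ M`. -/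
def MIrredComponentOf (n : ℕ) {M : Type*} [TopologicalSpace M] [ChartedSpace (Cn n) M] (V C : Set M) : Prop :=
  MIrredAnalytic n C ∧ C ⊆ V ∧ ∀ C', MIrredAnalytic n C' → C ⊆ C' → C' ⊆ V → C' = C

/-- The local dimension of `S ⊆ M` at `p` equals `d` (via Hausdorff dimension of chart
images on small neighborhoods). -/
def MLocDimEq (n : ℕ) {M : Type*} [TopologicalSpace M] [ChartedSpace (Cn n) M] (S : Set M) (p : M) (d : ℕ) : Prop :=
  ∀ᶠ U in (𝓝 p).smallSets,
    dimH (chartAt (Cn n) p '' (S ∩ U ∩ (chartAt (Cn n) p).source)) = ((2 * d : ℕ) : ℝ≥0∞)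

/-- The dimension of `S ⊆ M` equals `d`. -/
def MDimEq (n : ℕ) {M : Type*} [TopologicalSpace M] [ChartedSpace (Cn n) M] (S : Set M) (d : ℕ) : Prop :=
  (∀ p : M, ∀ᶠ U in (𝓝 p).smallSets,
    dimH (chartAt (Cn n) p '' (S ∩ U ∩ (chartAt (Cn n) p).source)) ≤ ((2 * d : ℕ) : ℝ≥0∞)) ∧
  ∃ p : M, MLocDimEq n S p d

end Manifold

end


noncomputable section
/-- Superposition (Nemytskii) power series. -/
def nemSeries {E K : Type*} [NormedAddCommGroup E] [NormedSpace ℂ E] [TopologicalSpace K]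
    [CompactSpace K] (p : FormalMultilinearSeries ℂ E ℂ) :
    FormalMultilinearSeries ℂ C(K, E) C(K, ℂ) := fun n =>
  MultilinearMap.mkContinuous
    { toFun := fun m => ⟨fun θ => p n (fun i => m i θ), by fun_prop⟩
      map_update_add' := by
        intro _ m i x y
        ext θ
        have h : ∀ w : C(K, E), (fun j => (Function.update m i w) j θ)
            = Function.update (fun j => m j θ) i (w θ) := by
          intro w; ext j; by_cases hj : j = i
          · subst hj; simp
          · simp [hj]
        simp [h]
      map_update_smul' := by
        intro _ m i c x
        ext θ
        have h : ∀ w : C(K, E), (fun j => (Function.update m i w) j θ)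
            = Function.update (fun j => m j θ) i (w θ) := by
          intro w; ext j; by_cases hj : j = i
          · subst hj; simp
          · simp [hj]
        simp [h] } ‖p n‖ (by
      intro m
      rw [ContinuousMap.norm_le _ (by positivity)]
      intro θ
      refine ((p n).le_opNorm _).trans ?_
      gcongr with i
      exact (m i).norm_coe_le_norm θ)

theorem nemSeries_radius {E K : Type*} [NormedAddCommGroup E] [NormedSpace ℂ E] [TopologicalSpace K]
    [CompactSpace K] (p : FormalMultilinearSeries ℂ E ℂ) :
    p.radius ≤ (nemSeries (K := K) p).radius :=
  FormalMultilinearSeries.radius_le_of_le fun _ =>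
    MultilinearMap.mkContinuous_norm_le _ (norm_nonneg _) _

theorem nem_exists {E K : Type*} [NormedAddCommGroup E] [NormedSpace ℂ E] [TopologicalSpace K]
    [CompactSpace K] {f : E → ℂ} (hf : AnalyticAt ℂ f 0) :
    ∃ R > (0:ℝ), ∃ Φ : C(K, E) → C(K, ℂ), (∀ φ, ‖φ‖ < R → AnalyticAt ℂ Φ φ) ∧
      ∀ φ, ‖φ‖ < R → ∀ θ, Φ φ θ = f (φ θ) := by
  obtain ⟨p, r, hp⟩ := hf
  obtain ⟨R, hR0, hRr⟩ := ENNReal.lt_iff_exists_nnreal_btwn.1 hp.r_pos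
  have hrad : r ≤ (nemSeries (K := K) p).radius := hp.r_le.trans (nemSeries_radius p)
  have hq := (nemSeries (K := K) p).hasFPowerSeriesOnBall (hp.r_pos.trans_le hrad)
  have key : ∀ φ : C(K, E), ‖φ‖ < R → (‖φ‖ₑ : ℝ≥0∞) < r := by
    intro φ h
    refine lt_trans ?_ hRr
    rw [enorm_eq_nnnorm]
    exact_mod_cast h
  refine ⟨R, by exact_mod_cast hR0, (nemSeries p).sum, ?_, ?_⟩
  · intro φ h
    apply hq.analyticAt_of_mem
    simpa using (key φ h).trans_le hrad
  · intro φ h θ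
    have h1 := hq.hasSum (y := φ) (by simpa using (key φ h).trans_le hrad)
    have h2 := h1.map (ContinuousMap.evalCLM ℂ θ) (ContinuousMap.evalCLM ℂ θ).continuous
    have h3 := hp.hasSum (y := φ θ) (by
      have := key φ h
      simp only [Metric.mem_eball, edist_zero_right]
      refine lt_of_le_of_lt ?_ this
      rw [enorm_eq_nnnorm, enorm_eq_nnnorm]
      exact_mod_cast φ.norm_coe_le_norm θ)
    rw [zero_add] at h3
    have := h2.unique (a₂ := f (φ θ)) h3
    simpa using this

def avgLM (φ : C(Icc (0:ℝ) (2 * Real.pi), ℂ)) : ℂ :=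
  (2 * Real.pi)⁻¹ • ∫ θ in (0:ℝ)..(2 * Real.pi), φ (projIcc 0 (2 * Real.pi) Real.two_pi_pos.le θ)

theorem avg_continuous_aux (φ : C(Icc (0:ℝ) (2 * Real.pi), ℂ)) :
    Continuous fun θ => φ (projIcc 0 (2 * Real.pi) Real.two_pi_pos.le θ) :=
  φ.continuous.comp continuous_projIcc

def avgCLM : C(Icc (0:ℝ) (2 * Real.pi), ℂ) →L[ℂ] ℂ :=
  LinearMap.mkContinuous
    { toFun := avgLM
      map_add' := by
        intro φ ψ
        unfold avgLM
        rw [← smul_add, ← intervalIntegral.integral_add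
          ((avg_continuous_aux φ).intervalIntegrable _ _)
          ((avg_continuous_aux ψ).intervalIntegrable _ _)]
        rfl
      map_smul' := by
        intro c φ
        unfold avgLM
        rw [RingHom.id_apply, smul_comm c]
        congr 1
        exact intervalIntegral.integral_smul c _ } 1 (by
      intro φ
      have h := intervalIntegral.norm_integral_le_of_norm_le_const (a := 0) (b := 2 * Real.pi)
        (f := fun θ => φ (projIcc 0 (2 * Real.pi) Real.two_pi_pos.le θ)) (C := ‖φ‖)
        (fun x _ => φ.norm_coe_le_norm _)
      have hp := Real.two_pi_pos
      change ‖avgLM φ‖ ≤ _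
      unfold avgLM
      rw [norm_smul, norm_inv, Real.norm_of_nonneg hp.le, inv_mul_le_iff₀ hp]
      rw [sub_zero, abs_of_pos hp] at h
      linarith)

theorem avg_analytic {E : Type*} [NormedAddCommGroup E] [NormedSpace ℂ E] {g h : E → ℂ}
    (hg : AnalyticAt ℂ g 0) (hh : AnalyticAt ℂ h 0) :
    ∃ R > (0:ℝ), ∀ (u : E) (r : ℝ), 0 < r → r * ‖u‖ < R →
      (∀ s : ℂ, ‖s‖ = r → g (s • u) ≠ 0) →
      ∃ F : E → ℂ, AnalyticAt ℂ F 0 ∧ ∀ᶠ z in 𝓝 (0:E), (∀ s : ℂ, ‖s‖ = r → g (z + s • u) ≠ 0) ∧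
        F z = Real.circleAverage (fun s => h (z + s • u) / g (z + s • u)) 0 r := by
  obtain ⟨R1, hR1, G, hGa, hG⟩ := nem_exists (K := Icc (0:ℝ) (2 * Real.pi)) hg
  obtain ⟨R2, hR2, H, hHa, hH⟩ := nem_exists (K := Icc (0:ℝ) (2 * Real.pi)) hh
  refine ⟨min R1 R2, lt_min hR1 hR2, ?_⟩
  intro u r hr hru hne
  let φ0 : C(Icc (0:ℝ) (2 * Real.pi), E) := ⟨fun θ => circleMap 0 r θ • u, by
    have := continuous_circleMap 0 r
    fun_prop⟩
  let L : E →L[ℂ] C(Icc (0:ℝ) (2 * Real.pi), E) := ContinuousLinearMap.const ℂ _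
  let ι : E → C(Icc (0:ℝ) (2 * Real.pi), E) := fun z => L z + φ0
  have hιa : AnalyticAt ℂ ι 0 := (L.analyticAt 0).add analyticAt_const
  have hι0 : ι 0 = φ0 := by simp [ι]
  have hιv : ∀ z θ, ι z θ = z + circleMap 0 r θ • u := fun z θ => rfl
  have hn0 : ‖ι 0‖ < min R1 R2 := by
    rw [hι0]
    refine lt_of_le_of_lt ?_ hru
    rw [ContinuousMap.norm_le _ (by positivity)]
    intro θ
    change ‖circleMap 0 r θ • u‖ ≤ _
    rw [norm_smul, norm_circleMap_zero, abs_of_pos hr]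
  have hev : ∀ᶠ z in 𝓝 (0:E), ‖ι z‖ < min R1 R2 :=
    hιa.continuousAt.norm.eventually_lt_const hn0
  have hunit : IsUnit (G (ι 0)) := by
    rw [ContinuousMap.isUnit_iff_forall_ne_zero]
    intro θ
    rw [hG _ (hn0.trans_le (min_le_left _ _)), hιv, zero_add]
    exact hne _ (by rw [norm_circleMap_zero, abs_of_pos hr])
  have hGι : AnalyticAt ℂ (fun z => G (ι z)) 0 :=
    AnalyticAt.fun_comp (hGa _ (hn0.trans_le (min_le_left _ _))) hιa
  have hHι : AnalyticAt ℂ (fun z => H (ι z)) 0 :=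
    AnalyticAt.fun_comp (hHa _ (hn0.trans_le (min_le_right _ _))) hιa
  have hinv : AnalyticAt ℂ (fun z => Ring.inverse (G (ι z))) 0 := by
    have := analyticAt_inverse (𝕜 := ℂ) hunit.unit
    exact AnalyticAt.fun_comp (f := fun z => G (ι z)) this hGι
  refine ⟨fun z => avgCLM (H (ι z) * Ring.inverse (G (ι z))),
    (avgCLM.analyticAt _).comp (hHι.mul hinv), ?_⟩
  have hue : ∀ᶠ z in 𝓝 (0:E), IsUnit (G (ι z)) := by
    have := Units.isOpen (R := C(Icc (0:ℝ) (2 * Real.pi), ℂ)) |>.mem_nhds hunit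
    exact hGι.continuousAt this
  filter_upwards [hev, hue] with z hz hu
  have hz1 := hz.trans_le (min_le_left _ _)
  have hz2 := hz.trans_le (min_le_right _ _)
  refine ⟨?_, ?_⟩
  · intro s hs
    have hs' : s ∈ circleMap 0 r '' Icc 0 (2 * Real.pi) := by
      have : s ∈ circleMap 0 r '' Ioc 0 (2 * Real.pi) := by
        rw [image_circleMap_Ioc]; simp [hs, abs_of_pos hr]
      exact image_mono Ioc_subset_Icc_self this
    obtain ⟨θ, hθ, rfl⟩ := hs'
    rw [ContinuousMap.isUnit_iff_forall_ne_zero] at hu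
    have := hu ⟨θ, hθ⟩
    rwa [hG _ hz1, hιv] at this
  · change avgLM _ = _
    unfold avgLM Real.circleAverage
    congr 1
    apply intervalIntegral.integral_congr
    intro θ hθ
    rw [uIcc_of_le Real.two_pi_pos.le] at hθ
    have hmul : Ring.inverse (G (ι z)) ⟨θ, hθ⟩ = (G (ι z) ⟨θ, hθ⟩)⁻¹ := by
      have h1 := Ring.inverse_mul_cancel _ hu
      have h2 := congrArg (fun f => f ⟨θ, hθ⟩) h1
      exact eq_inv_of_mul_eq_one_left h2
    simp only [projIcc_of_mem _ hθ, ContinuousMap.mul_apply, hmul, hH _ hz2, hG _ hz1, hιv]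
    rw [div_eq_mul_inv]

theorem exists_line_proj {n : ℕ} (u : Fin n → ℂ) (hu : u ≠ 0) :
    ∃ π : (Fin n → ℂ) →ₗ[ℂ] (Fin (n - 1) → ℂ), Function.Surjective π ∧ π u = 0 := by
  have h1 : Module.finrank ℂ ((Fin n → ℂ) ⧸ (Submodule.span ℂ {u})) = n - 1 := by
    have := Submodule.finrank_quotient_add_finrank (Submodule.span ℂ {u})
    rw [finrank_span_singleton hu] at this
    simp at this
    omega
  let e := LinearEquiv.ofFinrankEq ((Fin n → ℂ) ⧸ (Submodule.span ℂ {u})) (Fin (n - 1) → ℂ)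
    (by rw [h1, Module.finrank_fin_fun])
  refine ⟨e.toLinearMap ∘ₗ (Submodule.span ℂ {u}).mkQ, ?_, ?_⟩
  · exact e.surjective.comp (Submodule.mkQ_surjective _)
  · simp [Submodule.mem_span_singleton_self]

theorem finrank_real_pi (k : ℕ) : Module.finrank ℝ (Fin k → ℂ) = 2 * k := by
  rw [Module.finrank_pi_fintype]; simp [mul_comm]

/-- Points whose line in direction `u` misses a set of codimension at least two are dense. -/
theorem dense_lines {n : ℕ} (hn : 2 ≤ n) (S : Set (Fin n → ℂ))
    (hS : dimH S + 4 ≤ 2 * (n : ℝ≥0∞)) (u : Fin n → ℂ) (hu : u ≠ 0) :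
    Dense {z : Fin n → ℂ | ∀ s : ℂ, z + s • u ∉ S} := by
  obtain ⟨π, hs, hπ⟩ := exists_line_proj u hu
  let πc := LinearMap.toContinuousLinearMap π
  have h1 : dimH (π '' S) ≤ dimH S := πc.lipschitz.dimH_image_le S
  have h2 : dimH (π '' S) < Module.finrank ℝ (Fin (n - 1) → ℂ) := by
    rw [finrank_real_pi]
    refine lt_of_le_of_lt h1 ?_
    obtain ⟨k, rfl⟩ : ∃ k, n = k + 2 := ⟨n - 2, by omega⟩
    have h3 : dimH S ≤ ((2 * k : ℕ) : ℝ≥0∞) := by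
      have : ((2 * k : ℕ) : ℝ≥0∞) + 4 = 2 * ((k + 2 : ℕ) : ℝ≥0∞) := by
        push_cast; ring
      rw [← this] at hS
      exact (ENNReal.add_le_add_iff_right (by simp)).1 hS
    refine lt_of_le_of_lt h3 ?_
    norm_cast
    omega
  have h3 := (dense_compl_of_dimH_lt_finrank h2).preimage
    (LinearMap.isOpenMap_of_finiteDimensional π hs)
  refine h3.mono ?_
  intro z hz s hzs
  apply hz
  exact ⟨_, hzs, by simp [hπ]⟩

/-- Division across a set of codimension at least two. -/
theorem hartogs_div {n : ℕ} (hn : 2 ≤ n) {ι : Type*} [Finite ι] (g h : ι → (Fin n → ℂ) → ℂ)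
    (hg : ∀ i, AnalyticAt ℂ (g i) 0) (hh : ∀ i, AnalyticAt ℂ (h i) 0)
    (hS : ∃ U ∈ 𝓝 (0 : Fin n → ℂ), dimH ({z | ∀ i, g i z = 0} ∩ U) + 4 ≤ 2 * (n : ℝ≥0∞))
    (hc : ∀ᶠ z in 𝓝 (0 : Fin n → ℂ), (∃ i, g i z ≠ 0) → ∃ c : ℂ, ∀ i, h i z = c * g i z) :
    ∃ F : (Fin n → ℂ) → ℂ, AnalyticAt ℂ F 0 ∧ ∀ᶠ z in 𝓝 (0 : Fin n → ℂ),
      ∀ i, h i z = F z * g i z := by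
  obtain ⟨U, hU, hSU⟩ := hS
  have hall : ∀ᶠ z in 𝓝 (0 : Fin n → ℂ), (∀ i, AnalyticAt ℂ (g i) z) ∧ (∀ i, AnalyticAt ℂ (h i) z) ∧
      z ∈ U ∧ ((∃ i, g i z ≠ 0) → ∃ c : ℂ, ∀ i, h i z = c * g i z) := by
    filter_upwards [eventually_all.2 fun i => (hg i).eventually_analyticAt,
      eventually_all.2 fun i => (hh i).eventually_analyticAt, hU, hc] with z h1 h2 h3 h4
    exact ⟨h1, h2, h3, h4⟩
  obtain ⟨ε, hε, hB⟩ := Metric.eventually_nhds_iff_ball.1 hall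
  set S := {z | ∀ i, g i z = 0} ∩ U with hSdef
  -- a nonzero point off the singular set
  have hw : ∃ w : Fin n → ℂ, w ≠ 0 ∧ w ∈ Metric.ball (0 : Fin n → ℂ) ε ∧ w ∉ S := by
    have hd : dimH (S ∪ {0}) < Module.finrank ℝ (Fin n → ℂ) := by
      rw [finrank_real_pi, dimH_union, dimH_singleton]
      refine max_lt ?_ ?_
      · have hlt := Real.dimH_lt_top S
        refine lt_of_lt_of_le (ENNReal.lt_add_right hlt.ne (b := 4) (by simp)) ?_
        exact_mod_cast hSU
      · norm_cast; omega
    obtain ⟨w, hwb, hwS⟩ := (dense_compl_of_dimH_lt_finrank hd).inter_open_nonempty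
      (Metric.ball 0 ε) Metric.isOpen_ball ⟨0, by simpa using hε⟩
    exact ⟨w, fun h0 => hwS (Or.inr h0), hwb, fun h0 => hwS (Or.inl h0)⟩
  obtain ⟨u, hu0, huB, huS⟩ := hw
  obtain ⟨i0, hi0⟩ : ∃ i, g i u ≠ 0 := by
    by_contra hcon
    push Not at hcon
    exact huS ⟨hcon, (hB u huB).2.2.1⟩
  have huB' : ‖u‖ < ε := by simpa using huB
  have hupos : 0 < ‖u‖ := norm_pos_iff.2 hu0
  obtain ⟨R, hR, hAvg⟩ := avg_analytic (hg i0) (hh i0)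
  -- the restriction of `g i0` to the line
  have hline : ∀ s ∈ Metric.closedBall (0:ℂ) 1, AnalyticAt ℂ (fun s : ℂ => g i0 (s • u)) s := by
    intro s hs
    have hs' : ‖s‖ ≤ 1 := by simpa using hs
    have : s • u ∈ Metric.ball (0 : Fin n → ℂ) ε := by
      rw [mem_ball_zero_iff, norm_smul]
      nlinarith
    have h1 : AnalyticAt ℂ (fun s : ℂ => s • u) s := by fun_prop
    exact AnalyticAt.fun_comp (g := g i0) (f := fun s : ℂ => s • u) ((hB _ this).1 i0) h1
  have hne : ∀ᶠ s in 𝓝[≠] (0:ℂ), g i0 (s • u) ≠ 0 := by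
    rcases (hline 0 (by simp)).eventually_eq_zero_or_eventually_ne_zero with h0 | h0
    · exfalso
      have := AnalyticOnNhd.eqOn_zero_of_preconnected_of_eventuallyEq_zero
        (f := fun s : ℂ => g i0 (s • u)) hline
        (convex_closedBall (0:ℂ) 1).isPreconnected (z₀ := 0) (by simp) h0
      have h1 := this (x := 1) (by simp)
      simp at h1
      exact hi0 h1
    · exact h0
  obtain ⟨δ, hδ, hδne⟩ := Metric.eventually_nhds_iff_ball.1 (eventually_nhdsWithin_iff.1 hne)
  obtain ⟨r, hr0, hrlt⟩ : ∃ r : ℝ, 0 < r ∧ r < min δ (min (R / ‖u‖) (ε / 2 / ‖u‖)) :=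
    exists_between (lt_min hδ (lt_min (by positivity) (by positivity)))
  have hrδ : r < δ := hrlt.trans_le (min_le_left _ _)
  have hrR : r * ‖u‖ < R :=
    (lt_div_iff₀ hupos).1 (hrlt.trans_le ((min_le_right _ _).trans (min_le_left _ _)))
  have hrε : r * ‖u‖ < ε / 2 :=
    (lt_div_iff₀ hupos).1 (hrlt.trans_le ((min_le_right _ _).trans (min_le_right _ _)))
  obtain ⟨F, hFa, hF⟩ := hAvg u r hr0 hrR (by
    intro s hs
    refine hδne s (by simpa [hs] using hrδ) ?_
    intro h0
    rw [mem_singleton_iff] at h0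
    rw [h0, norm_zero] at hs
    exact hr0.ne hs)
  refine ⟨F, hFa, ?_⟩
  have hev : ∀ᶠ z in 𝓝 (0 : Fin n → ℂ), AnalyticAt ℂ F z ∧ ‖z‖ < ε / 2 ∧
      (∀ s : ℂ, ‖s‖ = r → g i0 (z + s • u) ≠ 0) ∧
        F z = Real.circleAverage (fun s => h i0 (z + s • u) / g i0 (z + s • u)) 0 r := by
    filter_upwards [hFa.eventually_analyticAt, hF, Metric.ball_mem_nhds _ (half_pos hε)]
      with z h1 h2 h3
    exact ⟨h1, by simpa using h3, h2.1, h2.2⟩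
  obtain ⟨η, hη, hηB⟩ := Metric.eventually_nhds_iff_ball.1 hev
  have hdense := dense_lines hn S hSU u hu0
  -- equality on the dense set
  have heq : ∀ z ∈ Metric.ball (0 : Fin n → ℂ) η ∩ {z | ∀ s : ℂ, z + s • u ∉ S},
      ∀ i, h i z = F z * g i z := by
    rintro z ⟨hz, hzS⟩
    obtain ⟨-, hzε, hznz, hFz⟩ := hηB z hz
    have hin : ∀ s : ℂ, ‖s‖ ≤ r → z + s • u ∈ Metric.ball (0 : Fin n → ℂ) ε := by
      intro s hs
      rw [mem_ball_zero_iff]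
      have h1 := norm_add_le z (s • u)
      rw [norm_smul] at h1
      nlinarith
    have hnz : ∀ s : ℂ, ‖s‖ ≤ r → ∃ i, g i (z + s • u) ≠ 0 := by
      intro s hs
      by_contra hcon
      push Not at hcon
      exact hzS s ⟨hcon, (hB _ (hin s hs)).2.2.1⟩
    have hcc : ∀ s : ℂ, ∃ c : ℂ, ‖s‖ ≤ r → ∀ i, h i (z + s • u) = c * g i (z + s • u) := by
      intro s
      by_cases hs : ‖s‖ ≤ r
      · obtain ⟨c, hc⟩ := (hB _ (hin s hs)).2.2.2 (hnz s hs)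
        exact ⟨c, fun _ => hc⟩
      · exact ⟨0, fun h => absurd h hs⟩
    choose f hf using hcc
    have hfd : ∀ s ∈ Metric.closedBall (0:ℂ) r,
        ContinuousWithinAt f (Metric.closedBall (0:ℂ) r) s ∧
        (s ∈ Metric.ball (0:ℂ) r → DifferentiableAt ℂ f s) := by
      intro s hs
      have hs' : ‖s‖ ≤ r := by simpa using hs
      obtain ⟨i, hi⟩ := hnz s hs'
      have hl : AnalyticAt ℂ (fun s : ℂ => z + s • u) s := by fun_prop
      have ha : AnalyticAt ℂ (fun s : ℂ => h i (z + s • u) / g i (z + s • u)) s :=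
        (AnalyticAt.fun_comp (g := h i) (f := fun s : ℂ => z + s • u) ((hB _ (hin s hs')).2.1 i) hl).div
        (AnalyticAt.fun_comp (g := g i) (f := fun s : ℂ => z + s • u) ((hB _ (hin s hs')).1 i) hl) hi
      have hgi : ∀ᶠ t in 𝓝 s, g i (z + t • u) ≠ 0 :=
        (AnalyticAt.fun_comp (g := g i) (f := fun s : ℂ => z + s • u)
          ((hB _ (hin s hs')).1 i) hl).continuousAt.eventually_ne hi
      have hval : ∀ t, ‖t‖ ≤ r → g i (z + t • u) ≠ 0 →
          f t = h i (z + t • u) / g i (z + t • u) := by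
        intro t ht hgt
        rw [hf t ht i, mul_div_cancel_right₀ _ hgt]
      refine ⟨?_, ?_⟩
      · refine ha.continuousAt.continuousWithinAt.congr_of_eventuallyEq ?_ (hval s hs' hi)
        filter_upwards [self_mem_nhdsWithin, mem_nhdsWithin_of_mem_nhds hgi] with t ht hgt
        exact hval t (by simpa using ht) hgt
      · intro hsb
        refine ha.differentiableAt.congr_of_eventuallyEq ?_
        filter_upwards [Metric.isOpen_ball.mem_nhds hsb, hgi] with t ht hgt
        exact hval t (by simpa using (Metric.ball_subset_closedBall ht)) hgt
    have hdc : DiffContOnCl ℂ f (Metric.ball (0:ℂ) |r|) := by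
      rw [abs_of_pos hr0]
      refine ⟨fun s hs => ((hfd s (Metric.ball_subset_closedBall hs)).2 hs).differentiableWithinAt, ?_⟩
      rw [closure_ball _ hr0.ne']
      exact fun s hs => (hfd s hs).1
    have hmean := hdc.circleAverage
    have hFf : F z = f 0 := by
      rw [hFz, ← hmean]
      apply Real.circleAverage_congr_sphere
      intro s hs
      have hs' : ‖s‖ = r := by simpa [abs_of_pos hr0] using hs
      change h i0 (z + s • u) / g i0 (z + s • u) = f s
      rw [hf s hs'.le i0, mul_div_cancel_right₀ _ (hznz s hs')]
    intro i
    have := hf 0 (by simpa using hr0.le) i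
    rw [hFf]
    simpa using this
  filter_upwards [Metric.ball_mem_nhds (0 : Fin n → ℂ) hη, Metric.ball_mem_nhds (0 : Fin n → ℂ) hε] with z hz hzε i
  have hcl : z ∈ closure (Metric.ball (0 : Fin n → ℂ) η ∩ {z | ∀ s : ℂ, z + s • u ∉ S}) :=
    hdense.open_subset_closure_inter Metric.isOpen_ball hz
  have hnb := mem_closure_iff_nhdsWithin_neBot.1 hcl
  have hcF := (hηB z hz).1.continuousAt
  have hcg := ((hB z hzε).1 i).continuousAt
  have hch := ((hB z hzε).2.1 i).continuousAt
  have t1 := hch.tendsto.mono_left (nhdsWithin_le_nhds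
    (s := Metric.ball (0 : Fin n → ℂ) η ∩ {z | ∀ s : ℂ, z + s • u ∉ S}))
  have t2 := (hcF.mul hcg).tendsto.mono_left (nhdsWithin_le_nhds
    (s := Metric.ball (0 : Fin n → ℂ) η ∩ {z | ∀ s : ℂ, z + s • u ∉ S}))
  refine tendsto_nhds_unique_of_eventuallyEq t1 t2 ?_
  filter_upwards [self_mem_nhdsWithin] with y hy
  exact heq y hy i

theorem topForm_eq {N : ℕ} (Θ : AlternatingMap ℂ (Cn N) ℂ (Fin N)) (w : Fin N → Cn N) :
    Θ w = Θ (Pi.basisFun ℂ (Fin N)) * (Matrix.of w).det := by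
  conv_lhs => rw [AlternatingMap.eq_smul_basis_det (Pi.basisFun ℂ (Fin N)) Θ]
  simp only [AlternatingMap.smul_apply, smul_eq_mul, Pi.basisFun_det]
  rfl

theorem topForm_analytic {N : ℕ} {Θ : Form N N} (hΘ : HolFormAt 0 Θ) (w : Fin N → VF N)
    (hw : ∀ i, AnalyticAt ℂ (w i) 0) : AnalyticAt ℂ (fun z => Θ z (fun i => w i z)) 0 := by
  have h : (fun z => Θ z (fun i => w i z)) = fun z => Θ z (Pi.basisFun ℂ (Fin N)) *
      (Matrix.of (fun i => w i z)).det := by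
    ext z; exact topForm_eq _ _
  rw [h]
  refine (hΘ _).mul ?_
  simp only [Matrix.det_apply']
  refine Finset.analyticAt_fun_sum _ fun σ _ => analyticAt_const.mul ?_
  refine Finset.analyticAt_fun_prod _ fun i _ => ?_
  exact (analyticAt_pi_iff.1 (hw (σ i))) i

theorem map_update_comb {N : ℕ} (Θ : AlternatingMap ℂ (Cn N) ℂ (Fin N)) (W : Fin N → Cn N)
    (c : Fin N → ℂ) (l : Fin N) :
    Θ (Function.update W l (∑ i, c i • W i)) = c l * Θ W := by
  rw [AlternatingMap.map_update_sum, Finset.sum_eq_single l]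
  · rw [AlternatingMap.map_update_smul, Function.update_eq_self, smul_eq_mul]
  · intro i _ hi
    rw [AlternatingMap.map_update_smul, AlternatingMap.map_update_self _ _ hi.symm, smul_zero]
  · simp

theorem basis_of_ne {N : ℕ} (Θ : AlternatingMap ℂ (Cn N) ℂ (Fin N)) (W : Fin N → Cn N)
    (hW : Θ W ≠ 0) (x : Cn N) : ∃ c : Fin N → ℂ, x = ∑ i, c i • W i := by
  have hli : LinearIndependent ℂ W := by
    by_contra h
    exact hW (Θ.map_linearDependent W h)
  have hsp := hli.span_eq_top_of_card_eq_finrank' (by simp)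
  have hx : x ∈ Submodule.span ℂ (range W) := by rw [hsp]; trivial
  obtain ⟨c, hc⟩ := (Submodule.mem_span_range_iff_exists_fun ℂ).1 hx
  exact ⟨c, hc.symm⟩

theorem update_append_left {α : Type*} {k m : ℕ} (xs : Fin k → α) (v : Fin m → α) (a : Fin k)
    (x : α) : Function.update (Fin.append xs v) (Fin.castAdd m a) x =
      Fin.append (Function.update xs a x) v := by
  ext i
  refine Fin.addCases (fun b => ?_) (fun b => ?_) i
  · by_cases hb : b = a
    · subst hb; simp
    · have : Fin.castAdd m b ≠ Fin.castAdd m a := by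
        intro h; exact hb (Fin.castAdd_injective _ _ h)
      simp [this, hb]
  · have : Fin.natAdd k b ≠ Fin.castAdd m a := by
      intro h
      have := congrArg Fin.val h
      simp at this
      omega
    simp [this]

theorem update_append_right {α : Type*} {k m : ℕ} (xs : Fin k → α) (v : Fin m → α) (a : Fin m)
    (x : α) : Function.update (Fin.append xs v) (Fin.natAdd k a) x =
      Fin.append xs (Function.update v a x) := by
  ext i
  refine Fin.addCases (fun b => ?_) (fun b => ?_) i
  · have : Fin.castAdd m b ≠ Fin.natAdd k a := by
      intro h
      have := congrArg Fin.val h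
      simp at this
      omega
    simp [this]
  · by_cases hb : b = a
    · subst hb; simp
    · have : Fin.natAdd k b ≠ Fin.natAdd k a := by
        intro h; exact hb (Fin.natAdd_injective _ _ h)
      simp [this, hb]

theorem map_update_append {k m : ℕ} (Θ : AlternatingMap ℂ (Cn (k + m)) ℂ (Fin (k + m)))
    (xs : Fin k → Cn (k + m)) (v : Fin m → Cn (k + m)) (c : Fin k → ℂ) (a : Fin k) :
    Θ (Fin.append (Function.update xs a (∑ b, c b • xs b)) v) = c a * Θ (Fin.append xs v) := by
  have h := map_update_comb Θ (Fin.append xs v) (Fin.append c 0) (Fin.castAdd m a)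
  rw [Fin.sum_univ_add] at h
  simp only [Fin.append_left, Fin.append_right, Pi.zero_apply, zero_smul,
    Finset.sum_const_zero, add_zero] at h
  rwa [update_append_left] at h

/-- At a point where the form does not vanish, tangent vectors are combinations of the generators. -/
theorem tangent_comb {k m : ℕ} (Θ : AlternatingMap ℂ (Cn (k + m)) ℂ (Fin (k + m)))
    (xs : Fin k → Cn (k + m)) (v : Fin m → Cn (k + m)) (hv : Θ (Fin.append xs v) ≠ 0)
    (x : Cn (k + m)) (hx : ∀ (w : Fin m → Cn (k + m)) (i : Fin m), w i = x →
      Θ (Fin.append xs w) = 0) : ∃ c : Fin k → ℂ, x = ∑ a, c a • xs a := by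
  obtain ⟨c, hc⟩ := basis_of_ne Θ _ hv x
  have hz : ∀ b : Fin m, c (Fin.natAdd k b) = 0 := by
    intro b
    have h := map_update_comb Θ (Fin.append xs v) c (Fin.natAdd k b)
    rw [← hc, update_append_right, hx _ b (by simp)] at h
    exact (mul_eq_zero.1 h.symm).resolve_right hv
  refine ⟨fun a => c (Fin.castAdd m a), ?_⟩
  conv_lhs => rw [hc]
  rw [Fin.sum_univ_add]
  simp [hz]

theorem append_li {k m : ℕ} (xs : Fin k → Cn (k + m)) (hxs : LinearIndependent ℂ xs) :
    ∃ v : Fin m → Cn (k + m), LinearIndependent ℂ (Fin.append xs v) := by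
  obtain ⟨q, hq⟩ := Submodule.exists_isCompl (Submodule.span ℂ (range xs))
  have h1 := Submodule.finrank_add_eq_of_isCompl hq
  rw [finrank_span_eq_card hxs] at h1
  simp only [Fintype.card_fin, Module.finrank_fin_fun] at h1
  have hqm : Module.finrank ℂ q = m := by omega
  let b := Module.finBasisOfFinrankEq ℂ q hqm
  have hv : LinearIndependent ℂ (fun i => (b i : Cn (k + m))) :=
    b.linearIndependent.map' q.subtype (Submodule.ker_subtype q)
  refine ⟨fun i => (b i : Cn (k + m)), ?_⟩
  have hs := hxs.sum_type hv (hq.disjoint.mono_right (by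
    rw [Submodule.span_le]
    rintro _ ⟨i, rfl⟩
    exact (b i).2))
  have he : Fin.append xs (fun i => (b i : Cn (k + m))) =
      (Sum.elim xs fun i => (b i : Cn (k + m))) ∘ finSumFinEquiv.symm := by
    ext1 i
    refine Fin.addCases (fun b => ?_) (fun b => ?_) i <;> simp
  rw [he]
  exact hs.comp _ finSumFinEquiv.symm.injective

theorem topForm_ne {N : ℕ} (Θ : AlternatingMap ℂ (Cn N) ℂ (Fin N)) (hΘ : Θ ≠ 0) (w : Fin N → Cn N)
    (hw : LinearIndependent ℂ w) : Θ w ≠ 0 := by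
  let b := basisOfLinearIndependentOfCardEqFinrank' w hw (by simp)
  intro h
  apply hΘ
  rw [AlternatingMap.eq_smul_basis_det b Θ]
  have : (b : Fin N → Cn N) = w := by simp [b]
  rw [this, h, zero_smul]

theorem germCodim_dimH {N : ℕ} (hN : 2 ≤ N) {V : Set (Cn N)} (h : GermCodimGE N 0 V 2) :
    ∃ U ∈ 𝓝 (0 : Cn N), dimH (V ∩ U) + 4 ≤ 2 * (N : ℝ≥0∞) := by
  obtain ⟨U, hU, h⟩ := h
  refine ⟨U, hU, ?_⟩
  rcases h with h | h
  · rw [h, dimH_empty, zero_add]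
    norm_cast
    omega
  · have h4 : (2 : ℝ≥0∞) * ((2 : ℕ) : ℝ≥0∞) = 4 := by norm_num
    rwa [h4] at h

theorem form_eq_zero {N m : ℕ} (ω : AlternatingMap ℂ (Cn N) ℂ (Fin m))
    (h : ∀ I : Fin m → Fin N, ω (fun i => Pi.basisFun ℂ (Fin N) (I i)) = 0) : ω = 0 := by
  refine Module.Basis.ext_alternating (Pi.basisFun ℂ (Fin N)) ?_
  intro I _
  simpa using h I

theorem theta_ne {k m : ℕ} (hN : 2 ≤ k + m) (ω : Form (k + m) m)
    (hcod : GermCodimGE (k + m) 0 (zeroLocus ω) 2) (Xs : Fin k → VF (k + m))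
    (Θ : Form (k + m) (k + m)) (hΘ : HolFormAt 0 Θ)
    (hω : ∀ᶠ z in 𝓝 (0 : Cn (k + m)), ∀ v : Fin m → Cn (k + m),
      ω z v = Θ z (Fin.append (fun a => Xs a z) v)) : Θ 0 ≠ 0 := by
  obtain ⟨U, hU, hd⟩ := germCodim_dimH hN hcod
  obtain ⟨F, -, hF⟩ := hartogs_div hN (ι := Unit) (fun _ z => Θ z (Pi.basisFun ℂ (Fin (k + m))))
    (fun _ _ => 1) (fun _ => hΘ _) (fun _ => analyticAt_const) (by
      refine ⟨_, inter_mem hU hω, le_trans (add_le_add_left (dimH_mono ?_) _) hd⟩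
      rintro z ⟨h1, h2, h3⟩
      refine ⟨?_, h2⟩
      change ω z = 0
      ext v
      have h1' : Θ z (Pi.basisFun ℂ (Fin (k + m))) = 0 := h1 ()
      have h3' : ω z v = Θ z (Fin.append (fun a => Xs a z) v) := h3 v
      rw [h3', topForm_eq, h1', zero_mul]; rfl) (by
      refine Eventually.of_forall fun z hz => ?_
      obtain ⟨-, hz⟩ := hz
      exact ⟨(Θ z (Pi.basisFun ℂ (Fin (k + m))))⁻¹, fun _ => (inv_mul_cancel₀ hz).symm⟩)
  have h0 := hF.self_of_nhds ()
  intro h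
  simp [h] at h0

/-- A tangent germ is a combination of the generators with holomorphic coefficients. -/
theorem tangent_germ {k m : ℕ} (hN : 2 ≤ k + m) (ω : Form (k + m) m)
    (hhol : HolFormAt 0 ω)
    (hcod : GermCodimGE (k + m) 0 (zeroLocus ω) 2) (Xs : Fin k → VF (k + m))
    (hXs : ∀ a, AnalyticAt ℂ (Xs a) 0)
    (Θ : Form (k + m) (k + m)) (hΘ : HolFormAt 0 Θ)
    (hω : ∀ᶠ z in 𝓝 (0 : Cn (k + m)), ∀ v : Fin m → Cn (k + m),
      ω z v = Θ z (Fin.append (fun a => Xs a z) v))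
    (X : VF (k + m)) (hX : AnalyticAt ℂ X 0)
    (htan : ∀ᶠ z in 𝓝 (0 : Cn (k + m)), TangentAt ω X z) :
    ∃ f : Fin k → Cn (k + m) → ℂ, (∀ a, AnalyticAt ℂ (f a) 0) ∧
      ∀ᶠ z in 𝓝 (0 : Cn (k + m)), X z = ∑ a, f a z • Xs a z := by
  obtain ⟨U, hU, hd⟩ := germCodim_dimH hN hcod
  have hpt : ∀ᶠ z in 𝓝 (0 : Cn (k + m)), ω z ≠ 0 → ∃ c : Fin k → ℂ,
      X z = ∑ a, c a • Xs a z := by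
    filter_upwards [hω, htan] with z h1 h2 h3
    obtain ⟨v, hv⟩ : ∃ v, ω z v ≠ 0 := by
      by_contra hcon
      push Not at hcon
      exact h3 (by ext v; exact hcon v)
    rw [h1] at hv
    refine tangent_comb (Θ z) _ v hv (X z) ?_
    intro w i hw
    rw [← h1]
    exact h2 w i hw
  let e : (Fin m → Fin (k + m)) → Fin m → Cn (k + m) :=
    fun I i => Pi.basisFun ℂ (Fin (k + m)) (I i)
  have hdiv : ∀ a : Fin k, ∃ F : Cn (k + m) → ℂ, AnalyticAt ℂ F 0 ∧
      ∀ᶠ z in 𝓝 (0 : Cn (k + m)), ∀ I : Fin m → Fin (k + m),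
        Θ z (Fin.append (Function.update (fun b => Xs b z) a (X z)) (e I)) = F z * ω z (e I) := by
    intro a
    refine hartogs_div hN (fun I z => ω z (e I))
      (fun I z => Θ z (Fin.append (Function.update (fun b => Xs b z) a (X z)) (e I)))
      (fun I => hhol _) (fun I => ?_) ⟨U, hU, le_trans (add_le_add_left (dimH_mono ?_) _) hd⟩ ?_
    · have := topForm_analytic hΘ (fun i z =>
        Fin.append (Function.update (fun b => Xs b z) a (X z)) (e I) i) (by
          intro i
          refine Fin.addCases (fun b => ?_) (fun b => ?_) i
          · simp only [Fin.append_left]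
            by_cases hb : b = a
            · subst hb; simpa using hX
            · simpa [hb] using hXs b
          · simp only [Fin.append_right]
            exact analyticAt_const)
      exact this
    · rintro z ⟨h1, h2⟩
      exact ⟨form_eq_zero _ h1, h2⟩
    · filter_upwards [hpt, hω] with z h1 h2 h3
      obtain ⟨I, hI⟩ := h3
      obtain ⟨c, hc⟩ := h1 (by intro h0; rw [h0] at hI; exact hI rfl)
      refine ⟨c a, fun J => ?_⟩
      rw [h2, hc]
      exact map_update_append (Θ z) _ _ c a
  choose f hfa hf using hdiv
  refine ⟨f, hfa, ?_⟩
  have hsum : AnalyticAt ℂ (fun z => ∑ a, f a z • Xs a z) 0 :=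
    Finset.analyticAt_fun_sum _ fun a _ => (hfa a).smul (hXs a)
  have hoff : ∀ᶠ z in 𝓝 (0 : Cn (k + m)), ω z ≠ 0 → X z = ∑ a, f a z • Xs a z := by
    filter_upwards [hpt, hω, eventually_all.2 hf] with z h1 h2 h3 h4
    obtain ⟨c, hc⟩ := h1 h4
    obtain ⟨I, hI⟩ : ∃ I, ω z (e I) ≠ 0 := by
      by_contra hcon
      push Not at hcon
      exact h4 (form_eq_zero _ hcon)
    have hcf : ∀ a, c a = f a z := by
      intro a
      have h5 := h3 a I
      rw [hc, map_update_append (Θ z), ← h2] at h5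
      exact mul_right_cancel₀ hI h5
    simpa only [hcf] using hc
  have hdense : Dense (zeroLocus ω ∩ U)ᶜ := by
    apply dense_compl_of_dimH_lt_finrank
    rw [finrank_real_pi]
    refine lt_of_lt_of_le (ENNReal.lt_add_right (Real.dimH_lt_top _).ne (b := 4) (by simp)) ?_
    exact_mod_cast hd
  have hcont : ∀ᶠ z in 𝓝 (0 : Cn (k + m)), ContinuousAt X z ∧
      ContinuousAt (fun z => ∑ a, f a z • Xs a z) z := by
    filter_upwards [hX.eventually_analyticAt, hsum.eventually_analyticAt] with z h1 h2
    exact ⟨h1.continuousAt, h2.continuousAt⟩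
  filter_upwards [hcont, hoff.eventually_nhds, eventually_eventually_nhds.2 hU] with z h1 h2 h3
  have hnb := mem_closure_iff_nhdsWithin_neBot.1 (hdense z)
  have t1 := h1.1.tendsto.mono_left (nhdsWithin_le_nhds (s := (zeroLocus ω ∩ U)ᶜ))
  have t2 := h1.2.tendsto.mono_left (nhdsWithin_le_nhds (s := (zeroLocus ω ∩ U)ᶜ))
  refine tendsto_nhds_unique_of_eventuallyEq t1 t2 ?_
  filter_upwards [self_mem_nhdsWithin, mem_nhdsWithin_of_mem_nhds h2,
    mem_nhdsWithin_of_mem_nhds h3] with y hy hy2 hy3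
  exact hy2 fun h0 => hy ⟨h0, hy3⟩

theorem range_fderiv_le {N k : ℕ} (X : VF N) (Xs : Fin k → VF N)
    (hXs : ∀ a, AnalyticAt ℂ (Xs a) 0) (f : Fin k → Cn N → ℂ) (hf : ∀ a, AnalyticAt ℂ (f a) 0)
    (hX : ∀ᶠ z in 𝓝 (0 : Cn N), X z = ∑ a, f a z • Xs a z) (hf0 : ∀ a, f a 0 = 0) :
    LinearMap.range (fderiv ℂ X 0).toLinearMap ≤
      Submodule.span ℂ (range fun a => Xs a 0) := by
  have h1 : HasFDerivAt (fun z => ∑ a, f a z • Xs a z)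
      (∑ a, (f a 0 • fderiv ℂ (Xs a) 0 + (fderiv ℂ (f a) 0).smulRight (Xs a 0))) 0 :=
    HasFDerivAt.fun_sum fun a _ =>
      (hf a).differentiableAt.hasFDerivAt.smul (hXs a).differentiableAt.hasFDerivAt
  have h2 := (h1.congr_of_eventuallyEq hX).fderiv
  rintro _ ⟨v, rfl⟩
  rw [h2]
  change (∑ a, (f a 0 • fderiv ℂ (Xs a) 0 + (fderiv ℂ (f a) 0).smulRight (Xs a 0))) v ∈
    Submodule.span ℂ (range fun a => Xs a 0)
  rw [ContinuousLinearMap.sum_apply]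
  refine Submodule.sum_mem _ fun a _ => ?_
  rw [hf0, ContinuousLinearMap.add_apply, ContinuousLinearMap.smul_apply, zero_smul, zero_add,
    ContinuousLinearMap.smulRight_apply]
  exact Submodule.smul_mem _ _ (Submodule.subset_span ⟨a, rfl⟩)

/-- If a coefficient is a unit, `X` can replace the corresponding generator. -/
theorem replace_gen {j m : ℕ} (ω : Form (j + 1 + m) m) (Xs : Fin (j + 1) → VF (j + 1 + m))
    (hXs : ∀ a, AnalyticAt ℂ (Xs a) 0)
    (Θ : Form (j + 1 + m) (j + 1 + m)) (hΘ : HolFormAt 0 Θ)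
    (hω : ∀ᶠ z in 𝓝 (0 : Cn (j + 1 + m)), ∀ v : Fin m → Cn (j + 1 + m),
      ω z v = Θ z (Fin.append (fun a => Xs a z) v))
    (X : VF (j + 1 + m)) (hX : AnalyticAt ℂ X 0)
    (f : Fin (j + 1) → Cn (j + 1 + m) → ℂ) (hfa : ∀ a, AnalyticAt ℂ (f a) 0)
    (hf : ∀ᶠ z in 𝓝 (0 : Cn (j + 1 + m)), X z = ∑ a, f a z • Xs a z)
    (i : Fin (j + 1)) (hi : f i 0 ≠ 0) :
    ∃ (Ys : Fin j → VF (j + 1 + m)) (Θ : Form (j + 1 + m) (j + 1 + m)),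
      (∀ i, AnalyticAt ℂ (Ys i) 0) ∧
        HolFormAt 0 Θ ∧ ∀ᶠ z in 𝓝 (0 : Cn (j + 1 + m)), ∀ v : Fin m → Cn (j + 1 + m),
          ω z v = Θ z (Fin.append (fun a => (Fin.cons X Ys : Fin (j + 1) → VF (j + 1 + m)) a z) v) := by
  let Z : Fin (j + 1) → VF (j + 1 + m) := Function.update Xs i X
  have hZ : ∀ a, AnalyticAt ℂ (Z a) 0 := by
    intro a
    by_cases ha : a = i
    · subst ha; simpa [Z] using hX
    · simpa [Z, ha] using hXs a
  let σ : Equiv.Perm (Fin (j + 1 + m)) := Equiv.swap (Fin.castAdd m 0) (Fin.castAdd m i)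
  let s : ℂ := ((Equiv.Perm.sign σ : ℤ) : ℂ)
  have hs : s * s = 1 := by
    simp only [s]
    rcases Int.units_eq_one_or (Equiv.Perm.sign σ) with h | h <;> simp [h]
  refine ⟨fun l => Z (Equiv.swap 0 i l.succ), fun z => (s * (f i z)⁻¹) • Θ z, fun l => hZ _, ?_, ?_⟩
  · intro v
    exact (analyticAt_const.mul ((hfa i).inv hi)).mul (hΘ v)
  · filter_upwards [hω, hf, (hfa i).continuousAt.eventually_ne hi] with z h1 h2 h3 v
    have hcons : (fun a => (Fin.cons X (fun l : Fin j => Z (Equiv.swap 0 i l.succ)) :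
        Fin (j + 1) → VF (j + 1 + m)) a z) = fun a => Z (Equiv.swap 0 i a) z := by
      ext1 a
      refine Fin.cases ?_ (fun l => ?_) a
      · simp [Z]
      · simp
    have happ : Fin.append (fun a => Z (Equiv.swap 0 i a) z) v =
        Fin.append (fun a => Z a z) v ∘ σ := by
      ext1 l
      refine Fin.addCases (fun b => ?_) (fun b => ?_) l
      · have : σ (Fin.castAdd m b) = Fin.castAdd m (Equiv.swap 0 i b) := by
          simp only [σ, Equiv.swap_apply_def, (Fin.castAdd_injective (j + 1) m).eq_iff]
          split_ifs <;> rfl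
        simp [this]
      · have : σ (Fin.natAdd (j + 1) b) = Fin.natAdd (j + 1) b := by
          apply Equiv.swap_apply_of_ne_of_ne <;>
          · intro h
            have := congrArg Fin.val h
            simp at this
            try omega
        simp [this]
    have hZz : (fun a => Z a z) = Function.update (fun a => Xs a z) i (∑ a, f a z • Xs a z) := by
      ext1 a
      by_cases ha : a = i
      · subst ha; simp [Z, h2]
      · simp [Z, ha]
    have hperm : Θ z (Fin.append (fun a => Z a z) v ∘ σ) = s * (f i z * ω z v) := by
      rw [AlternatingMap.map_perm, hZz, map_update_append (Θ z), ← h1, Units.smul_def, zsmul_eq_mul]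
    rw [hcons, happ, AlternatingMap.smul_apply, hperm, smul_eq_mul]
    have : s * (f i z)⁻¹ * (s * (f i z * ω z v)) = (s * s) * ((f i z)⁻¹ * f i z) * ω z v := by ring
    rw [this, hs, inv_mul_cancel₀ h3]
    simp

end

/-- Theorem 5.1: Let `D` be a germ of `k`-dimensional distribution at
`0 ∈ ℂⁿ` (here `k = j + 1`, `n = k + m`) with locally free tangent sheaf, defined by the
germ of `(n-k)`-form `ω`, and `X` a germ of vector field with `X 0 = 0`, tangent to `D`,
of linear rank at least `k`. Then exactly one of: (1) `ω = i_X i_{Y₁} ⋯ i_{Y_{k-1}} Θ`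
for germs `Y₁, …, Y_{k-1}`, `Θ` — which happens iff `sing X ⊆ sing D`; (2) `D` is
regular, in which case the linear rank of `X` is exactly `k`. -/
theorem statement_14 (n j m : ℕ) (hm : 1 ≤ m) (hn : n = (j + 1) + m)
    (ω : Form n m) (hdist : IsGermDist n m ω)
    (hfree : GermLocFreeK n (j + 1) m hn ω)
    (X : VF n) (hX : AnalyticAt ℂ X 0) (hX0 : X 0 = 0)
    (htan : ∀ᶠ z in 𝓝 (0 : Cn n), TangentAt ω X z)
    (hrk : j + 1 ≤ rkAt X 0) :
    ((∃ (Ys : Fin j → VF n) (Θ : Form n n), (∀ i, AnalyticAt ℂ (Ys i) 0) ∧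
        HolFormAt 0 Θ ∧ ∀ᶠ z in 𝓝 (0 : Cn n), ∀ v : Fin m → Cn n,
          ω z v = Θ z (fun i => Fin.append (fun a => (Fin.cons X Ys : Fin (j + 1) → VF n) a z) v (Fin.cast hn i)))
      ∨ ω 0 ≠ 0) ∧
    ¬((∃ (Ys : Fin j → VF n) (Θ : Form n n), (∀ i, AnalyticAt ℂ (Ys i) 0) ∧
        HolFormAt 0 Θ ∧ ∀ᶠ z in 𝓝 (0 : Cn n), ∀ v : Fin m → Cn n,
          ω z v = Θ z (fun i => Fin.append (fun a => (Fin.cons X Ys : Fin (j + 1) → VF n) a z) v (Fin.cast hn i)))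
      ∧ ω 0 ≠ 0) ∧
    ((∃ (Ys : Fin j → VF n) (Θ : Form n n), (∀ i, AnalyticAt ℂ (Ys i) 0) ∧
        HolFormAt 0 Θ ∧ ∀ᶠ z in 𝓝 (0 : Cn n), ∀ v : Fin m → Cn n,
          ω z v = Θ z (fun i => Fin.append (fun a => (Fin.cons X Ys : Fin (j + 1) → VF n) a z) v (Fin.cast hn i)))
      ↔ ∃ U ∈ 𝓝 (0 : Cn n), ∀ z ∈ U, X z = 0 → ω z = 0) ∧
    (ω 0 ≠ 0 → rkAt X 0 = j + 1) := by
  subst hn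
  obtain ⟨Xs, Θ, hXs, hΘ, hω⟩ := hfree
  simp only [Fin.cast_refl, id_eq] at hω ⊢
  obtain ⟨⟨U, hU, hholU, -⟩, hcod⟩ := hdist
  have hhol : HolFormAt 0 ω := fun v => hholU v 0 (mem_of_mem_nhds hU)
  have hN : 2 ≤ j + 1 + m := by omega
  obtain ⟨f, hfa, hf⟩ := tangent_germ hN ω hhol hcod Xs hXs Θ hΘ hω X hX htan
  have hΘ0 := theta_ne hN ω hcod Xs Θ hΘ hω
  have hsing : ∀ (Ys : Fin j → VF (j + 1 + m)) (Θ' : Form (j + 1 + m) (j + 1 + m)),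
      (∀ᶠ z in 𝓝 (0 : Cn (j + 1 + m)), ∀ v : Fin m → Cn (j + 1 + m), ω z v = Θ' z (Fin.append
        (fun a => (Fin.cons X Ys : Fin (j + 1) → VF (j + 1 + m)) a z) v)) →
      ∀ᶠ z in 𝓝 (0 : Cn (j + 1 + m)), X z = 0 → ω z = 0 := by
    intro Ys Θ' h
    filter_upwards [h] with z hz hXz
    ext v
    rw [hz]
    exact (Θ' z).map_coord_zero (Fin.castAdd m 0) (by simp [hXz])
  by_cases hA : ∃ i, f i 0 ≠ 0
  · obtain ⟨i, hi⟩ := hA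
    have h1 := replace_gen ω Xs hXs Θ hΘ hω X hX f hfa hf i hi
    have hω0 : ω 0 = 0 := by
      obtain ⟨Ys, Θ', -, -, h⟩ := h1
      exact (hsing Ys Θ' h).self_of_nhds hX0
    refine ⟨Or.inl h1, fun h => h.2 hω0, ⟨fun _ => ?_, fun _ => h1⟩, fun h => absurd hω0 h⟩
    obtain ⟨Ys, Θ', -, -, h⟩ := h1
    exact ⟨_, hsing Ys Θ' h, fun z hz => hz⟩
  · push Not at hA
    have hle := range_fderiv_le X Xs hXs f hfa hf hA
    have hrk1 : rkAt X 0 ≤ Module.finrank ℂ (Submodule.span ℂ (range fun a => Xs a 0)) :=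
      Submodule.finrank_mono hle
    have hrk2 : Module.finrank ℂ (Submodule.span ℂ (range fun a => Xs a 0)) ≤ j + 1 := by
      have h := finrank_range_le_card (R := ℂ) (fun a => Xs a 0)
      rw [Fintype.card_fin] at h
      exact h
    have hli : LinearIndependent ℂ (fun a => Xs a 0) := by
      rw [linearIndependent_iff_card_le_finrank_span, Fintype.card_fin]
      exact hrk.trans hrk1
    obtain ⟨v, hv⟩ := append_li _ hli
    have hω0 : ω 0 ≠ 0 := by
      intro h0
      have h2 := hω.self_of_nhds v
      rw [h0] at h2
      exact topForm_ne (Θ 0) hΘ0 _ hv h2.symm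
    refine ⟨Or.inr hω0, ?_, ⟨?_, ?_⟩, fun _ => le_antisymm (hrk1.trans hrk2) hrk⟩
    · rintro ⟨⟨Ys, Θ', -, -, h⟩, -⟩
      exact hω0 ((hsing Ys Θ' h).self_of_nhds hX0)
    · rintro ⟨Ys, Θ', -, -, h⟩
      exact absurd ((hsing Ys Θ' h).self_of_nhds hX0) hω0
    · rintro ⟨V, hV, h⟩
      exact absurd (h 0 (mem_of_mem_nhds hV) hX0) hω0
end

section
/- Let ω be a germ of holomorphic (n−k)-form at 0 ∈ ℂ^n with ω(0) = 0, defining a germ of singular k-dimensional distribution with locally free tangent sheaf, and let X be a germ of holomorphic vector field at 0 with i_X ω = 0. If rank(DX(0)) ≥ k, then X divides ω, i.e. there is a germ of holomorphic (n−k+1)-form Θ at 0 with ω = i_X Θ. -/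
open Topology Filter Set
open scoped ENNReal Manifold

open MeasureTheory in
theorem local_param {E : Type*} [NormedAddCommGroup E] [NormedSpace ℂ E]
    (F : E → ℂ) (p : FormalMultilinearSeries ℂ E ℂ) (y0 : E) (ρ : ℝ≥0∞)
    (hp : HasFPowerSeriesOnBall F p y0 ρ) (q : NNReal) (hq0 : 0 < q)
    (hq : (q + q : ℝ≥0∞) < ρ) (γ : ℝ → E) (hγ : Continuous γ) (a b : ℝ)
    (hab : ∀ t ∈ uIcc a b, ‖γ t - y0‖ ≤ q) :
    (∀ᶠ z in 𝓝 (0 : E), IntervalIntegrable (fun t => F (z + γ t)) volume a b) ∧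
    AnalyticAt ℂ (fun z => ∫ t in a..b, F (z + γ t)) 0 := by
  have hqr : (q + q : ℝ≥0∞) < p.radius := hq.trans_le hp.r_le
  have hq1 : (q : ℝ≥0∞) < p.radius := lt_of_le_of_lt (le_add_right le_rfl) hqr
  have hnn : ∀ t ∈ uIcc a b, ‖γ t - y0‖₊ ≤ q := fun t ht => by
    rw [← NNReal.coe_le_coe]; simpa using hab t ht
  constructor
  · have : Metric.ball (0 : E) q ∈ 𝓝 (0 : E) := Metric.ball_mem_nhds _ (by exact_mod_cast hq0)
    filter_upwards [this] with z hz
    apply ContinuousOn.intervalIntegrable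
    refine hp.continuousOn.comp (by fun_prop) ?_
    intro t ht
    rw [Metric.mem_eball, edist_eq_enorm_sub]
    have h1 : ‖z + γ t - y0‖ₑ ≤ ‖z‖ₑ + ‖γ t - y0‖ₑ := by
      rw [add_sub_assoc]; exact enorm_add_le _ _
    refine lt_of_le_of_lt (h1.trans ?_) hq
    gcongr
    · rw [enorm_eq_nnnorm]
      have : ‖z‖ < q := by simpa using hz
      exact_mod_cast this.le
    · rw [enorm_eq_nnnorm]; exact_mod_cast hnn t ht
  let A : ℕ → NNReal := fun k =>
    ∑' s : Σ l : ℕ, { s : Finset (Fin (k + l)) // s.card = l }, ‖p (k + s.1)‖₊ * q ^ s.1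
  have hA : Summable fun k => A k * q ^ k := by
    simpa only [← NNReal.tsum_mul_right, A] using
      (NNReal.summable_sigma.1 (p.changeOriginSeries_summable_aux₁ hqr)).2
  have hA' : Summable fun k => (A k : ℝ) * (q : ℝ) ^ k := by exact_mod_cast hA
  have hbd : ∀ k, ∀ t ∈ uIcc a b, ‖p.changeOrigin (γ t - y0) k‖ ≤ A k := by
    intro k t ht
    have h1 : (‖γ t - y0‖₊ : ℝ≥0∞) < p.radius :=
      lt_of_le_of_lt (by exact_mod_cast hnn t ht) hq1
    have h2 := p.nnnorm_changeOrigin_le k h1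
    have h3 : ‖p.changeOrigin (γ t - y0) k‖₊ ≤ A k := by
      refine h2.trans ?_
      refine (p.changeOriginSeries_summable_aux₂ h1 k).tsum_le_tsum ?_
        (p.changeOriginSeries_summable_aux₂ hq1 k)
      intro s
      have := hnn t ht
      gcongr
    exact_mod_cast h3
  have hcont : ∀ k, ContinuousOn (fun t => p.changeOrigin (γ t - y0) k) (uIcc a b) := by
    intro k
    refine (p.hasFPowerSeriesOnBall_changeOrigin k (lt_of_le_of_lt bot_le hq1)).continuousOn.comp
      (by fun_prop) ?_
    intro t ht
    rw [Metric.mem_eball, edist_zero_right, enorm_eq_nnnorm]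
    exact lt_of_le_of_lt (by exact_mod_cast hnn t ht) hq1
  let P : FormalMultilinearSeries ℂ E ℂ := fun k => ∫ t in a..b, p.changeOrigin (γ t - y0) k
  have hP : HasFPowerSeriesOnBall (fun z => ∫ t in a..b, F (z + γ t)) P 0 q := by
    refine ⟨?_, by exact_mod_cast hq0, ?_⟩
    · apply P.le_radius_of_summable_norm
      refine Summable.of_nonneg_of_le (fun k => by positivity) (fun k => ?_)
        (hA'.mul_left |b - a|)
      have : ‖P k‖ ≤ A k * |b - a| :=
        intervalIntegral.norm_integral_le_of_norm_le_const fun t ht =>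
          hbd k t (uIoc_subset_uIcc ht)
      calc ‖P k‖ * (q : ℝ) ^ k ≤ (A k * |b - a|) * (q : ℝ) ^ k := by gcongr
        _ = _ := by ring
    · intro z hz
      rw [zero_add]
      have hz' : ‖z‖₊ < q := by
        rw [Metric.mem_eball, edist_zero_right, enorm_eq_nnnorm] at hz
        exact_mod_cast hz
      have hz'' : ‖z‖ ≤ q := by exact_mod_cast hz'.le
      have key : ∀ k, P k (fun _ => z) = ∫ t in a..b, p.changeOrigin (γ t - y0) k (fun _ => z) := by
        intro k
        exact ((ContinuousMultilinearMap.apply ℂ (fun _ : Fin k => E) ℂ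
          (fun _ => z)).intervalIntegral_comp_comm (hcont k).intervalIntegrable).symm
      simp only [key]
      refine intervalIntegral.hasSum_integral_of_dominated_convergence
        (fun k _ => (A k : ℝ) * (q : ℝ) ^ k) ?_ ?_ ?_ ?_ ?_
      · intro k
        have hc : ContinuousOn (fun t => p.changeOrigin (γ t - y0) k (fun _ => z)) (uIcc a b) :=
          (ContinuousMultilinearMap.apply ℂ (fun _ : Fin k => E) ℂ
          (fun _ => z)).continuous.comp_continuousOn (hcont k)
        exact (hc.mono uIoc_subset_uIcc).aestronglyMeasurable measurableSet_uIoc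
      · intro k
        refine Eventually.of_forall fun t ht => ?_
        refine (ContinuousMultilinearMap.le_opNorm _ _).trans ?_
        simp only [Finset.prod_const, Finset.card_univ, Fintype.card_fin]
        have := hbd k t (uIoc_subset_uIcc ht)
        gcongr
      · exact Eventually.of_forall fun t ht => hA'
      · exact intervalIntegrable_const
      · refine Eventually.of_forall fun t ht => ?_
        have ht := uIoc_subset_uIcc ht
        have h1 : (‖γ t - y0‖₊ : ℝ≥0∞) < ρ :=
          lt_of_le_of_lt (by exact_mod_cast hnn t ht)
            (lt_of_le_of_lt (le_add_right le_rfl) hq)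
        have := (hp.changeOrigin h1).hasSum (y := z) ?_
        · rw [show z + γ t = y0 + (γ t - y0) + z by abel]; exact this
        · rw [Metric.mem_eball, edist_zero_right, enorm_eq_nnnorm, lt_tsub_iff_right]
          refine lt_of_le_of_lt ?_ hq
          gcongr
          exact hnn t ht
  exact hP.analyticAt

open MeasureTheory in
theorem param {E : Type*} [NormedAddCommGroup E] [NormedSpace ℂ E]
    (F : E → ℂ) (γ : ℝ → E) (hγ : Continuous γ) (a b : ℝ) (hle : a ≤ b)
    (hF : ∀ t ∈ Icc a b, AnalyticAt ℂ F (γ t)) :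
    AnalyticAt ℂ (fun z => ∫ t in a..b, F (z + γ t)) 0 := by
  have loc : ∀ s : Icc a b, ∃ c : Set (Icc a b), IsOpen c ∧ s ∈ c ∧ ∀ u v : Icc a b, u ≤ v →
      Icc u v ⊆ c → (∀ᶠ z in 𝓝 (0 : E), IntervalIntegrable (fun t => F (z + γ t)) volume u v) ∧
    AnalyticAt ℂ (fun z => ∫ t in u..v, F (z + γ t)) 0 := by
    intro s
    obtain ⟨p, ρ, hp⟩ := hF s s.2
    obtain ⟨q, hq0, hq⟩ : ∃ q : NNReal, 0 < q ∧ (q + q : ℝ≥0∞) < ρ := by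
      obtain ⟨x, hx0, hx⟩ := ENNReal.lt_iff_exists_nnreal_btwn.1 hp.r_pos
      refine ⟨x / 2, by simpa using hx0, ?_⟩
      rw [← ENNReal.coe_add, add_halves]; exact hx
    refine ⟨{t | ‖γ t - γ s‖ < q}, ?_, by simpa using hq0, ?_⟩
    · exact isOpen_lt (by fun_prop) continuous_const
    · intro u v huv hc
      refine local_param F p (γ s) ρ hp q hq0 hq γ hγ u v ?_
      intro t ht
      rw [uIcc_of_le (show (u : ℝ) ≤ v from huv)] at ht
      exact (hc (show (⟨t, u.2.1.trans ht.1, ht.2.trans v.2.2⟩ : Icc a b) ∈ Icc u v from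
        ⟨ht.1, ht.2⟩)).le
  choose c hc1 hc2 hc3 using loc
  obtain ⟨t, ht0, htm, ⟨m, hm⟩, ht⟩ := exists_monotone_Icc_subset_open_cover_Icc hle hc1
    (fun s _ => mem_iUnion.2 ⟨s, hc2 s⟩)
  have : ∀ n, (∀ᶠ z in 𝓝 (0 : E), IntervalIntegrable (fun t => F (z + γ t)) volume a (t n)) ∧
    AnalyticAt ℂ (fun z => ∫ t in a..(t n), F (z + γ t)) 0 := by
    intro n
    induction n with
    | zero => simp [ht0, analyticAt_const]
    | succ n ih =>
      obtain ⟨i, hi⟩ := ht n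
      obtain ⟨h1, h2⟩ := hc3 i _ _ (htm n.le_succ) hi
      constructor
      · filter_upwards [ih.1, h1] with z hz1 hz2 using hz1.trans hz2
      · refine (ih.2.add h2).congr ?_
        filter_upwards [ih.1, h1] with z hz1 hz2
        exact intervalIntegral.integral_add_adjacent_intervals hz1 hz2
  have h := (this m).2
  rwa [hm m le_rfl] at h

theorem extend_across {n : ℕ} (hn : 1 ≤ n) (Z : Set (Fin n → ℂ)) (R : ℝ) (hR : 0 < R)
    (hZ : dimH (Z ∩ Metric.ball 0 R) + 2 * ((2 : ℕ) : ℝ≥0∞) ≤ 2 * (n : ℝ≥0∞)) :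
    ∃ D : Set (Fin n → ℂ), Dense D ∧ ∃ δ > 0, ∀ f : (Fin n → ℂ) → ℂ,
      (∀ z ∈ Metric.ball 0 R, z ∉ Z → AnalyticAt ℂ f z) →
      ∃ g : (Fin n → ℂ) → ℂ, AnalyticAt ℂ g 0 ∧
        ∀ z ∈ D, z ∈ Metric.ball 0 δ → z ∉ Z ∧ g z = f z := by
  obtain ⟨N, rfl⟩ : ∃ N, n = N + 1 := ⟨n - 1, by omega⟩
  have hdim : dimH (Z ∩ Metric.ball 0 R) < (Module.finrank ℝ (Fin N → ℂ) : ℝ≥0∞) := by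
    rw [finrank_real_of_complex, Module.finrank_fin_fun]
    have hfin : dimH (Z ∩ Metric.ball 0 R) ≠ ⊤ := by
      intro h
      rw [h, top_add] at hZ
      exact absurd hZ (by simp [ENNReal.mul_eq_top])
    lift dimH (Z ∩ Metric.ball 0 R) to NNReal using hfin with d
    have h1 : d + 2 * ((2 : ℕ) : NNReal) ≤ 2 * ((N + 1 : ℕ) : NNReal) := by exact_mod_cast hZ
    have h2 : d < ((2 * N : ℕ) : NNReal) := by
      rw [← NNReal.coe_lt_coe]
      rw [← NNReal.coe_le_coe] at h1
      push_cast at h1 ⊢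
      linarith
    exact_mod_cast h2
  -- the direction of the line
  obtain ⟨w, hw⟩ : ∃ w : Fin N → ℂ, ∀ z ∈ Z ∩ Metric.ball 0 R, z 0 ≠ 0 →
      w ≠ fun i => (z 0)⁻¹ * z i.succ := by
    let ψ : (Fin (N + 1) → ℂ) → (Fin N → ℂ) := fun z i => (z 0)⁻¹ * z i.succ
    let S := (Z ∩ Metric.ball 0 R) ∩ {z | z 0 ≠ 0}
    have h1 : dimH (ψ '' S) ≤ dimH S := by
      apply dimH_image_le_of_locally_lipschitzOn
      intro x hx
      have hx0 : x 0 ≠ 0 := hx.2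
      have hd : ContDiffAt ℝ 1 ψ x := by
        rw [contDiffAt_pi]
        intro i
        have ha : ∀ j, ContDiffAt ℝ 1 (fun z : Fin (N + 1) → ℂ => z j) x := fun j =>
          contDiffAt_apply ..
        exact ((ha 0).inv hx0).mul (ha _)
      obtain ⟨K, t, ht, hK⟩ := hd.exists_lipschitzOnWith
      exact ⟨K, t, mem_nhdsWithin_of_mem_nhds ht, hK⟩
    have h2 : dimH (ψ '' S) < (Module.finrank ℝ (Fin N → ℂ) : ℝ≥0∞) :=
      lt_of_le_of_lt (h1.trans (dimH_mono inter_subset_left)) hdim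
    obtain ⟨w, hw⟩ := (dense_compl_of_dimH_lt_finrank h2).nonempty
    refine ⟨w, fun z hz hz0 h => hw ⟨z, ⟨hz, hz0⟩, h.symm⟩⟩
  let e : Fin (N + 1) → ℂ := Fin.cons 1 w
  have hline : ∀ t : ℂ, t ≠ 0 → t • e ∈ Metric.ball 0 R → t • e ∉ Z := by
    intro t ht hb hz
    refine hw _ ⟨hz, hb⟩ (by simpa [e] using ht) ?_
    ext i
    simp [e, ht]
  -- the projection along the line
  let π : (Fin (N + 1) → ℂ) →L[ℂ] (Fin N → ℂ) :=
    ContinuousLinearMap.pi fun i =>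
      ContinuousLinearMap.proj i.succ - w i • ContinuousLinearMap.proj 0
  have hπ : ∀ z i, π z i = z i.succ - w i * z 0 := fun z i => by simp [π]
  have hπe : ∀ z (t : ℂ), π (z + t • e) = π z := by
    intro z t; ext i; rw [hπ, hπ]; simp [e]; ring
  have hsurj : Function.Surjective π := by
    intro y
    refine ⟨Fin.cons 0 y, ?_⟩
    ext i; rw [hπ]; simp
  have hdense : Dense (π '' (Z ∩ Metric.ball 0 R))ᶜ :=
    dense_compl_of_dimH_lt_finrank (lt_of_le_of_lt (π.lipschitz.dimH_image_le _) hdim)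
  let r : ℝ := R / (2 * (‖e‖ + 1))
  have hr : 0 < r := by positivity
  have hre : r * ‖e‖ < R / 2 := by
    have : r * (‖e‖ + 1) = R / 2 := by
      simp only [r]; field_simp
    nlinarith
  refine ⟨π ⁻¹' (π '' (Z ∩ Metric.ball 0 R))ᶜ, hdense.preimage (π.isOpenMap hsurj), R / 2,
    by positivity, fun f hf => ?_⟩
  refine ⟨fun z => Real.circleAverage (fun ζ => f (z + ζ • e)) 0 r, ?_, ?_⟩
  · have h := param f (fun θ => circleMap 0 r θ • e) (by fun_prop) 0 (2 * Real.pi)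
      (by positivity) ?_
    · simp only [Real.circleAverage_def]
      have := (analyticAt_const (v := (((2 * Real.pi)⁻¹ : ℝ) : ℂ)) (x := (0 : Fin (N + 1) → ℂ))
        (𝕜 := ℂ)).mul h
      refine this.congr (Eventually.of_forall fun z => ?_)
      simp [Complex.real_smul]
    · intro t _
      have hb : circleMap 0 r t • e ∈ Metric.ball 0 R := by
        rw [mem_ball_zero_iff, norm_smul, norm_circleMap_zero, abs_of_pos hr]; linarith
      exact hf _ hb (hline _ (circleMap_ne_center hr.ne') hb)
  · intro z hzD hz
    rw [mem_ball_zero_iff] at hz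
    have hav : ∀ ζ : ℂ, ζ ∈ Metric.closedBall 0 |r| → z + ζ • e ∈ Metric.ball 0 R ∧
        z + ζ • e ∉ Z := by
      intro ζ hζ
      have hb : z + ζ • e ∈ Metric.ball 0 R := by
        rw [mem_ball_zero_iff]
        rw [mem_closedBall_zero_iff, abs_of_pos hr] at hζ
        have h1 : ‖ζ • e‖ ≤ r * ‖e‖ := by rw [norm_smul]; gcongr
        linarith [norm_add_le z (ζ • e)]
      refine ⟨hb, fun h => hzD ⟨_, ⟨h, hb⟩, hπe _ _⟩⟩
    refine ⟨by simpa using (hav 0 (by simp)).2, ?_⟩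
    have hdiff : ∀ ζ ∈ Metric.closedBall (0 : ℂ) |r|,
        DifferentiableAt ℂ (fun ζ : ℂ => f (z + ζ • e)) ζ := by
      intro ζ hζ
      have h1 := (hf _ (hav ζ hζ).1 (hav ζ hζ).2).differentiableAt
      exact DifferentiableAt.comp ζ h1 (by fun_prop)
    have := circleAverage_of_differentiable_on_off_countable (countable_empty)
      (fun ζ hζ => (hdiff ζ hζ).continuousAt.continuousWithinAt)
      (fun ζ hζ => hdiff ζ (Metric.ball_subset_closedBall hζ.1))
    simpa using this

/-- Determinant of a family of `n` vectors of `ℂⁿ`. -/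
noncomputable def dt {n : ℕ} (W : Fin n → Cn n) : ℂ :=
  Matrix.detRowAlternating W

theorem dt_analytic {n : ℕ} {W : Cn n → Fin n → Cn n} {c : Cn n}
    (hW : ∀ i, AnalyticAt ℂ (fun z => W z i) c) : AnalyticAt ℂ (fun z => dt (W z)) c := by
  have h : ∀ z, dt (W z) = ∑ σ : Equiv.Perm (Fin n),
      (((Equiv.Perm.sign σ : ℤ)) : ℂ) * ∏ i, W z (σ i) i := fun z => Matrix.det_apply' _
  simp only [h]
  refine Finset.analyticAt_fun_sum _ fun σ _ => ?_
  refine analyticAt_const.mul (Finset.analyticAt_fun_prod _ fun i _ => ?_)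
  exact (analyticAt_pi_iff.1 (hW (σ i))) i

theorem append_update_left {k m : ℕ} {α : Type*} (Y : Fin k → α) (v : Fin m → α) (i : Fin k)
    (x : α) : Fin.append (Function.update Y i x) v =
      Function.update (Fin.append Y v) (Fin.castAdd m i) x := by
  ext j
  refine Fin.addCases (fun a => ?_) (fun a => ?_) j
  · by_cases h : a = i
    · subst h; simp
    · rw [Fin.append_left, Function.update_of_ne h, Function.update_of_ne, Fin.append_left]
      simpa [Fin.ext_iff] using h
  · rw [Fin.append_right, Function.update_of_ne, Fin.append_right]
    simp only [ne_eq, Fin.ext_iff, Fin.val_natAdd, Fin.val_castAdd]; omega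

theorem append_update_right {k m : ℕ} {α : Type*} (Y : Fin k → α) (v : Fin m → α) (i : Fin m)
    (x : α) : Fin.append Y (Function.update v i x) =
      Function.update (Fin.append Y v) (Fin.natAdd k i) x := by
  ext j
  refine Fin.addCases (fun a => ?_) (fun a => ?_) j
  · rw [Fin.append_left, Function.update_of_ne, Fin.append_left]
    simp only [ne_eq, Fin.ext_iff, Fin.val_natAdd, Fin.val_castAdd]; omega
  · by_cases h : a = i
    · subst h; simp
    · rw [Fin.append_right, Function.update_of_ne h, Function.update_of_ne, Fin.append_right]
      simpa [Fin.ext_iff] using h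

theorem cramer_pt {k m : ℕ} (Y : Fin k → Cn (k + m)) (x : Cn (k + m))
    (hx : ∀ (v : Fin m → Cn (k + m)) (i : Fin m), v i = x → dt (Fin.append Y v) = 0)
    (v : Fin m → Cn (k + m)) (hv : dt (Fin.append Y v) ≠ 0) :
    LinearIndependent ℂ Y ∧
      x = ∑ i, (dt (Fin.append (Function.update Y i x) v) / dt (Fin.append Y v)) • Y i := by
  have hli : LinearIndependent ℂ (Fin.append Y v) :=
    Matrix.linearIndependent_rows_of_det_ne_zero (A := Matrix.of (Fin.append Y v)) hv
  constructor
  · have := hli.comp (Fin.castAdd m) (Fin.castAdd_injective k m)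
    convert this using 1
    ext i : 1
    simp
  · let A : Matrix (Fin (k + m)) (Fin (k + m)) ℂ := Matrix.of (Fin.append Y v)
    have h1 := Matrix.mulVec_cramer A.transpose x
    have h2 : ∑ j, (dt (Function.update (Fin.append Y v) j x)) • Fin.append Y v j
        = dt (Fin.append Y v) • x := by
      rw [Matrix.det_transpose] at h1
      refine Eq.trans ?_ h1
      ext l
      simp only [Finset.sum_apply, Pi.smul_apply, smul_eq_mul, Matrix.mulVec, dotProduct,
        Matrix.transpose_apply, Matrix.cramer_transpose_apply]
      refine Finset.sum_congr rfl fun j _ => ?_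
      rw [mul_comm]; rfl
    rw [Fin.sum_univ_add] at h2
    have h3 : ∀ j : Fin m, dt (Function.update (Fin.append Y v) (Fin.natAdd k j) x) = 0 := by
      intro j
      rw [← append_update_right]
      exact hx _ j (by simp)
    simp only [h3, zero_smul, Finset.sum_const_zero, add_zero, ← append_update_left,
      Fin.append_left] at h2
    have h5 : ∑ i, (dt (Fin.append (Function.update Y i x) v) / dt (Fin.append Y v)) • Y i
        = (dt (Fin.append Y v))⁻¹ • ∑ i, dt (Fin.append (Function.update Y i x) v) • Y i := by
      rw [Finset.smul_sum]
      refine Finset.sum_congr rfl fun i _ => ?_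
      rw [smul_smul, div_eq_inv_mul]
    rw [h5, h2, smul_smul, inv_mul_cancel₀ hv, one_smul]

theorem exists_dt_ne_zero {k m : ℕ} (Y : Fin k → Cn (k + m)) (hY : LinearIndependent ℂ Y) :
    ∃ v : Fin m → Cn (k + m), dt (Fin.append Y v) ≠ 0 := by
  let b := Module.Basis.sumExtend hY
  have hfin : Finite (Fin k ⊕ (Module.Basis.sumExtendIndex hY)) := Module.Finite.finite_basis b
  have : Finite (Module.Basis.sumExtendIndex hY) :=
    Finite.of_injective (Sum.inr : _ → Fin k ⊕ (Module.Basis.sumExtendIndex hY)) Sum.inr_injective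
  have : Fintype (Module.Basis.sumExtendIndex hY) := Fintype.ofFinite _
  have hc : Fintype.card (Module.Basis.sumExtendIndex hY) = m := by
    have := Module.finrank_eq_card_basis b
    rw [Module.finrank_fin_fun, Fintype.card_sum, Fintype.card_fin] at this
    omega
  let e : Module.Basis.sumExtendIndex hY ≃ Fin m := Fintype.equivFinOfCardEq hc
  let b' : Module.Basis (Fin (k + m)) ℂ (Cn (k + m)) :=
    b.reindex ((Equiv.sumCongr (Equiv.refl _) e).trans finSumFinEquiv)
  refine ⟨fun j => b (Sum.inr (e.symm j)), ?_⟩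
  have hb : Fin.append Y (fun j => b (Sum.inr (e.symm j))) = b' := by
    ext j : 1
    refine Fin.addCases (fun a => ?_) (fun a => ?_) j
    · rw [Fin.append_left, Module.Basis.reindex_apply]
      simp [b, Module.Basis.sumExtend]
      rfl
    · rw [Fin.append_right, Module.Basis.reindex_apply]
      simp
  rw [hb]
  have := ((Pi.basisFun ℂ (Fin (k + m))).isUnit_det b').ne_zero
  rwa [Pi.basisFun_det] at this

theorem extend_update' {κ ι α : Type*} [DecidableEq κ] [DecidableEq ι] {σ : κ → ι}
    (hσ : Function.Injective σ) (w : κ → α) (b : ι → α) (a : κ) (x : α) :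
    Function.extend σ (Function.update w a x) b =
      Function.update (Function.extend σ w b) (σ a) x := by
  ext j
  by_cases hj : ∃ c, σ c = j
  · obtain ⟨c, rfl⟩ := hj
    rw [hσ.extend_apply]
    by_cases h : c = a
    · subst h; simp
    · rw [Function.update_of_ne h, Function.update_of_ne (fun h' => h (hσ h')), hσ.extend_apply]
  · rw [Function.extend_apply' _ _ _ hj, Function.update_of_ne, Function.extend_apply' _ _ _ hj]
    rintro rfl; exact hj ⟨a, rfl⟩

/-- Contraction of an alternating map with the vectors `b` outside the range of `σ`. -/
noncomputable def contractAlt {E : Type*} [AddCommGroup E] [Module ℂ E] {κ ι : Type*}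
    (f : AlternatingMap ℂ E ℂ ι) (σ : κ → ι) (hσ : Function.Injective σ) (b : ι → E) :
    AlternatingMap ℂ E ℂ κ where
  toFun w := f (Function.extend σ w b)
  map_update_add' := by
    haveI := Classical.decEq ι
    intro _ w i x y
    have h := fun x => extend_update' hσ w b i x
    rw [h, h, h, f.map_update_add]
  map_update_smul' := by
    haveI := Classical.decEq ι
    intro _ w i c x
    have h := fun x => extend_update' hσ w b i x
    rw [h, h, f.map_update_smul]
  map_eq_zero_of_eq' := by
    intro w i j hw hij
    exact f.map_eq_zero_of_eq _ (by rw [hσ.extend_apply, hσ.extend_apply, hw])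
      (fun h => hij (hσ h))

theorem statement_15 (n k m : ℕ) (hk : 1 ≤ k) (hm : 1 ≤ m) (hn : n = k + m)
    (ω : Form n m) (hω0 : ω 0 = 0) (hdist : IsGermDist n m ω)
    (hfree : GermLocFreeK n k m hn ω)
    (X : VF n) (hX : AnalyticAt ℂ X 0)
    (htan : ∀ᶠ z in 𝓝 (0 : Cn n), TangentAt ω X z)
    (hrk : k ≤ rkAt X 0) :
    DividesAt X ω 0 := by
  subst hn
  -- normalise: absorb the coefficient of the volume form into the first vector field
  obtain ⟨Y, hY, hYω⟩ : ∃ Y : Cn (k + m) → Fin k → Cn (k + m),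
      (∀ i, AnalyticAt ℂ (fun z => Y z i) 0) ∧
      ∀ᶠ z in 𝓝 (0 : Cn (k + m)), ∀ v, ω z v = dt (Fin.append (Y z) v) := by
    obtain ⟨Xs, Θ, hXs, hΘ, h⟩ := hfree
    let i0 : Fin k := ⟨0, hk⟩
    let u : Cn (k + m) → ℂ := fun z => Θ z (Pi.basisFun ℂ (Fin (k + m)))
    refine ⟨fun z => Function.update (fun a => Xs a z) i0 (u z • Xs i0 z), ?_, ?_⟩
    · intro i
      by_cases hi : i = i0
      · subst hi
        simp only [Function.update_self]
        exact (hΘ _).smul (hXs _)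
      · simp only [Function.update_of_ne hi]
        exact hXs i
    · filter_upwards [h] with z hz v
      rw [hz v, append_update_left]
      have h1 := (Θ z).eq_smul_basis_det (Pi.basisFun ℂ (Fin (k + m)))
      rw [Pi.basisFun_det] at h1
      rw [h1]
      simp only [dt]
      rw [AlternatingMap.map_update_smul, AlternatingMap.smul_apply]
      congr 2
      have : Xs i0 z = Fin.append (fun a => Xs a z) v (Fin.castAdd m i0) := by simp
      rw [this, Function.update_eq_self]
      rfl
  -- a good ball
  obtain ⟨U, hU, hUc⟩ := hdist.codim
  have hev : ∀ᶠ z in 𝓝 (0 : Cn (k + m)), z ∈ U ∧ TangentAt ω X z ∧ AnalyticAt ℂ X z ∧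
      (∀ i, AnalyticAt ℂ (fun z => Y z i) z) ∧ ∀ v, ω z v = dt (Fin.append (Y z) v) := by
    have h1 : ∀ᶠ z in 𝓝 (0 : Cn (k + m)), ∀ i, AnalyticAt ℂ (fun z => Y z i) z :=
      eventually_all.2 fun i => (hY i).eventually_analyticAt
    filter_upwards [hU, htan, hX.eventually_analyticAt, h1, hYω] with z a b c d e
      using ⟨a, b, c, d, e⟩
  obtain ⟨R, hR, hball⟩ := Metric.eventually_nhds_iff_ball.1 hev
  have hdim : dimH (zeroLocus ω ∩ Metric.ball 0 R) + 2 * ((2 : ℕ) : ℝ≥0∞) ≤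
      2 * ((k + m : ℕ) : ℝ≥0∞) := by
    rcases hUc with h | h
    · exact absurd (show (0 : Cn (k + m)) ∈ zeroLocus ω ∩ U from ⟨hω0, mem_of_mem_nhds hU⟩)
        (by rw [h]; simp)
    · refine le_trans ?_ h
      gcongr
      exact fun z hz => (hball z hz).1
  obtain ⟨D, hD, δ, hδ, hext⟩ := extend_across (by omega) (zeroLocus ω) R hR hdim
  -- coefficients away from the zero locus
  have hcoef : ∀ z ∈ Metric.ball (0 : Cn (k + m)) R, ∀ v, ω z v ≠ 0 →
      LinearIndependent ℂ (Y z) ∧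
      X z = ∑ i, (dt (Fin.append (Function.update (Y z) i (X z)) v) /
        dt (Fin.append (Y z) v)) • Y z i := by
    intro z hz v hv
    obtain ⟨-, ht, -, -, he⟩ := hball z hz
    refine cramer_pt (Y z) (X z) (fun v i hi => ?_) v ?_
    · rw [← he]; exact ht v i hi
    · rwa [← he]
  have hF : ∃ F : Fin k → Cn (k + m) → ℂ, ∀ z ∈ Metric.ball (0 : Cn (k + m)) R,
      z ∉ zeroLocus ω → X z = ∑ i, F i z • Y z i := by
    have : ∀ z : Cn (k + m), ∃ c : Fin k → ℂ, z ∈ Metric.ball (0 : Cn (k + m)) R →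
        z ∉ zeroLocus ω → X z = ∑ i, c i • Y z i := by
      intro z
      by_cases h : z ∈ Metric.ball (0 : Cn (k + m)) R ∧ ∃ v, ω z v ≠ 0
      · obtain ⟨hz, v, hv⟩ := h
        exact ⟨_, fun _ _ => (hcoef z hz v hv).2⟩
      · refine ⟨0, fun hz hz' => absurd ⟨hz, ?_⟩ h⟩
        by_contra! h0
        exact hz' (AlternatingMap.ext h0)
    choose c hc using this
    exact ⟨fun i z => c z i, hc⟩
  obtain ⟨F, hF⟩ := hF
  have hFan : ∀ i, ∀ z ∈ Metric.ball (0 : Cn (k + m)) R, z ∉ zeroLocus ω →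
      AnalyticAt ℂ (F i) z := by
    intro i z hz hz'
    obtain ⟨v, hv⟩ : ∃ v, ω z v ≠ 0 := by
      by_contra! h0
      exact hz' (AlternatingMap.ext h0)
    obtain ⟨-, -, hXz, hYz, he⟩ := hball z hz
    have hden : AnalyticAt ℂ (fun z => dt (Fin.append (Y z) v)) z := by
      apply dt_analytic
      intro j
      refine Fin.addCases (fun a => ?_) (fun a => ?_) j
      · simpa using hYz a
      · simpa using analyticAt_const
    have hnum : AnalyticAt ℂ (fun z => dt (Fin.append (Function.update (Y z) i (X z)) v)) z := by
      apply dt_analytic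
      intro j
      refine Fin.addCases (fun a => ?_) (fun a => ?_) j
      · by_cases ha : a = i
        · subst ha; simpa using hXz
        · simpa [Function.update_of_ne ha] using hYz a
      · simpa using analyticAt_const
    have hne : dt (Fin.append (Y z) v) ≠ 0 := by rwa [← he]
    refine (hnum.div hden hne).congr ?_
    filter_upwards [Metric.isOpen_ball.mem_nhds hz, hden.continuousAt.eventually_ne hne]
      with y hy hyv
    have hyv' : ω y v ≠ 0 := by rwa [(hball y hy).2.2.2.2]
    obtain ⟨hli, hsum⟩ := hcoef y hy v hyv'
    have hsum' := hF y hy (fun h => hyv' (by rw [show ω y = 0 from h]; rfl))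
    have := Fintype.linearIndependent_iff.1 hli
      (fun i => dt (Fin.append (Function.update (Y y) i (X y)) v) /
        dt (Fin.append (Y y) v) - F i y) (by
          simp only [sub_smul, Finset.sum_sub_distrib]
          rw [← hsum, ← hsum', sub_self]) i
    exact sub_eq_zero.1 this
  choose g hgan hg using fun i => hext (F i) (hFan i)
  -- `X` is a holomorphic combination of the `Y i`
  have hXg : ∀ᶠ z in 𝓝 (0 : Cn (k + m)), X z = ∑ i, g i z • Y z i := by
    have h1 : ∀ᶠ z in 𝓝 (0 : Cn (k + m)), ∀ i, AnalyticAt ℂ (g i) z :=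
      eventually_all.2 fun i => (hgan i).eventually_analyticAt
    filter_upwards [h1, Metric.ball_mem_nhds _ hR, Metric.ball_mem_nhds _ hδ] with z hgz hzR hzδ
    obtain ⟨-, -, hXz, hYz, he⟩ := hball z hzR
    have hc : ContinuousAt (fun z => X z - ∑ i, g i z • Y z i) z := by
      refine hXz.continuousAt.sub ?_
      refine tendsto_finsetSum _ fun i _ => ?_
      exact (hgz i).continuousAt.smul (hYz i).continuousAt
    by_contra hne
    have hne' : X z - ∑ i, g i z • Y z i ≠ 0 := sub_ne_zero.2 hne
    obtain ⟨y, hyD, hy⟩ := hD.inter_nhds_nonempty (Filter.inter_mem (hc.eventually_ne hne')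
      (Filter.inter_mem (Metric.isOpen_ball.mem_nhds hzR) (Metric.isOpen_ball.mem_nhds hzδ)))
    obtain ⟨hy1, hyR, hyδ⟩ := hy
    apply hy1
    have hyZ := (hg ⟨0, hk⟩ y hyD hyδ).1
    rw [hF y hyR hyZ, sub_eq_zero]
    exact Finset.sum_congr rfl fun i _ => by rw [(hg i y hyD hyδ).2]
  by_cases hcase : ∃ i, g i 0 ≠ 0
  · obtain ⟨i, hi⟩ := hcase
    let σ : Fin (m + 1) → Fin (k + m) := Fin.cons (Fin.castAdd m i) (Fin.natAdd k)
    have hσ : Function.Injective σ := by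
      refine Fin.cons_injective_iff.2 ⟨?_, Fin.natAdd_injective m k⟩
      rintro ⟨j, hj⟩
      simp only [Fin.ext_iff, Fin.val_natAdd, Fin.val_castAdd] at hj
      omega
    have hform : ∀ (y : Fin k → Cn (k + m)) (x : Cn (k + m)) (v : Fin m → Cn (k + m)),
        Function.extend σ (Fin.cons x v : Fin (m + 1) → Cn (k + m)) (Fin.append y 0) =
          Fin.append (Function.update y i x) v := by
      intro y x v
      ext j : 1
      refine Fin.addCases (fun a => ?_) (fun a => ?_) j
      · by_cases ha : a = i
        · subst ha
          have := hσ.extend_apply (Fin.cons x v : Fin (m + 1) → Cn (k + m)) (Fin.append y 0) 0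
          simpa [σ] using this
        · rw [Function.extend_apply', Fin.append_left, Fin.append_left, Function.update_of_ne ha]
          rintro ⟨c, hc⟩
          refine Fin.cases (fun hc => ?_) (fun c hc => ?_) c hc
          · exact ha (Fin.castAdd_injective k m hc).symm
          · simp only [σ, Fin.cons_succ, Fin.ext_iff, Fin.val_natAdd, Fin.val_castAdd] at hc
            omega
      · have := hσ.extend_apply (Fin.cons x v : Fin (m + 1) → Cn (k + m)) (Fin.append y 0) a.succ
        simpa [σ] using this
    refine ⟨fun z => (g i z)⁻¹ • contractAlt Matrix.detRowAlternating σ hσ (Fin.append (Y z) 0),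
      ?_, ?_⟩
    · intro w
      have h1 : AnalyticAt ℂ (fun z => dt (Function.extend σ w (Fin.append (Y z) 0))) 0 := by
        apply dt_analytic
        intro j
        by_cases hj : ∃ c, σ c = j
        · obtain ⟨c, rfl⟩ := hj
          simp only [hσ.extend_apply]
          exact analyticAt_const
        · simp only [Function.extend_apply' _ _ _ hj]
          refine Fin.addCases (fun a => ?_) (fun a => ?_) j
          · simpa using hY a
          · simpa using analyticAt_const
      exact ((hgan i).inv hi).mul h1
    · filter_upwards [hXg, hYω, (hgan i).continuousAt.eventually_ne hi] with z hz hzω hgi v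
      change ω z v = (g i z)⁻¹ * dt (Function.extend σ (Fin.cons (X z) v) (Fin.append (Y z) 0))
      rw [hform, hzω, append_update_left]
      have : dt (Function.update (Fin.append (Y z) v) (Fin.castAdd m i) (X z)) =
          g i z * dt (Fin.append (Y z) v) := by
        rw [hz]
        simp only [dt]
        rw [AlternatingMap.map_update_sum, Finset.sum_eq_single i]
        · rw [AlternatingMap.map_update_smul, smul_eq_mul]
          congr 2
          have : Y z i = Fin.append (Y z) v (Fin.castAdd m i) := by simp
          rw [this, Function.update_eq_self]
        · intro j _ hj
          rw [AlternatingMap.map_update_smul]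
          have : Y z j = Fin.append (Y z) v (Fin.castAdd m j) := by simp
          rw [this, AlternatingMap.map_update_self, smul_zero]
          simpa [Fin.ext_iff] using fun h => hj (Fin.ext h.symm)
        · simp
      rw [this, ← mul_assoc, inv_mul_cancel₀ hgi, one_mul]
  · -- all coefficients vanish at `0`: contradiction with the rank
    exfalso
    push Not at hcase
    have hdep : ¬ LinearIndependent ℂ (Y 0) := by
      intro h
      obtain ⟨v, hv⟩ := exists_dt_ne_zero (Y 0) h
      apply hv
      rw [← hYω.self_of_nhds v, hω0]; rfl
    have hder : HasFDerivAt X (∑ i, (fderiv ℂ (g i) 0).smulRight (Y 0 i)) 0 := by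
      have h1 : HasFDerivAt (fun z => ∑ i, g i z • Y z i)
          (∑ i, (fderiv ℂ (g i) 0).smulRight (Y 0 i)) 0 := by
        refine HasFDerivAt.fun_sum fun i _ => ?_
        have := (hgan i).differentiableAt.hasFDerivAt.smul (hY i).differentiableAt.hasFDerivAt
        simpa [hcase i] using this
      exact h1.congr_of_eventuallyEq hXg
    have hle : rkAt X 0 ≤ Set.finrank ℂ (Set.range (Y 0)) := by
      unfold rkAt
      rw [hder.fderiv]
      apply Submodule.finrank_mono
      rintro _ ⟨x, rfl⟩
      simp only [ContinuousLinearMap.coe_coe, ContinuousLinearMap.sum_apply,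
        ContinuousLinearMap.smulRight_apply]
      exact Submodule.sum_mem _ fun i _ =>
        Submodule.smul_mem _ _ (Submodule.subset_span ⟨i, rfl⟩)
    apply hdep
    rw [linearIndependent_iff_card_le_finrank_span, Fintype.card_fin]
    exact hrk.trans hle
end

section
/- Let X be a germ of holomorphic vector field at 0 ∈ ℂ^n with rank(DX(0)) ≥ p+1, where p is a nonnegative integer. Then X satisfies the division property by k-forms for every k with n−p ≤ k ≤ n−1; that is, for every germ of holomorphic k-form α at 0 with i_X α = 0 there exists a germ of holomorphic (k+1)-form β at 0 with α = i_X β. -/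
open Topology Filter Set
open scoped ENNReal Manifold

open Topology Filter Set
open scoped ENNReal

namespace DivAux

/-- Hadamard-type division lemma for analytic functions. -/
theorem exists_div {E : Type*} [NormedAddCommGroup E] [NormedSpace ℂ E]
    (g : E → ℂ) (hg : AnalyticAt ℂ g 0) (l : E →L[ℂ] ℂ) (u : E) :
    ∃ h : E → ℂ, AnalyticAt ℂ h 0 ∧ ∀ᶠ z in 𝓝 (0 : E), g z - g (z - l z • u) = l z * h z := by
  obtain ⟨p, hp⟩ := hg
  set P : E →L[ℂ] E := ContinuousLinearMap.id ℂ E - l.smulRight u with hP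
  have hPz : ∀ z, P z = z - l z • u := fun z => by simp [hP]
  let A : (m : ℕ) → Fin (m + 1) → Fin (m + 1) → (E →L[ℂ] E) := fun m j i =>
    if i ≤ j then ContinuousLinearMap.id ℂ E else P
  let c : (m : ℕ) → Fin (m + 1) → ContinuousMultilinearMap ℂ (fun _ : Fin m => E) ℂ := fun m j =>
    (((p (m + 1)).compContinuousLinearMap (A m j)).curryMid j) u
  let q : FormalMultilinearSeries ℂ E ℂ := fun m => ∑ j, c m j
  obtain ⟨K, r, hK, hr, hbound⟩ : ∃ (K r : ℝ), 0 < K ∧ 0 < r ∧ ∀ n, ‖p n‖ ≤ K * r ^ n := by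
    obtain ⟨C, r, hC, hr, h⟩ := p.le_mul_pow_of_radius_pos hp.radius_pos
    exact ⟨C, r, hC, hr, h⟩
  set M : ℝ := ‖P‖ + 1 with hM
  have hM1 : 1 ≤ M := by simp [hM]
  have hA : ∀ m j i, ‖A m j i‖ ≤ M := by
    intro m j i
    by_cases hij : i ≤ j
    · simp only [A, hij, if_true]
      exact ContinuousLinearMap.norm_id_le.trans hM1
    · simp only [A, hij, if_false]; simp [hM]
  have hc : ∀ m j, ‖c m j‖ ≤ K * r ^ (m + 1) * M ^ (m + 1) * ‖u‖ := by
    intro m j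
    refine (ContinuousLinearMap.le_opNorm _ _).trans ?_
    rw [ContinuousMultilinearMap.norm_curryMid]
    refine mul_le_mul_of_nonneg_right ?_ (norm_nonneg _)
    refine (ContinuousMultilinearMap.norm_compContinuousLinearMap_le _ _).trans ?_
    refine mul_le_mul (hbound _) ?_ (Finset.prod_nonneg fun _ _ => norm_nonneg _) (by positivity)
    refine (Finset.prod_le_prod (fun _ _ => norm_nonneg _) (fun i _ => hA m j i)).trans ?_
    simp
  have hq : ∀ m, ‖q m‖ ≤ (K * r * M * ‖u‖) * (2 * r * M) ^ m := by
    intro m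
    refine (norm_sum_le _ _).trans ?_
    refine (Finset.sum_le_sum fun j _ => hc m j).trans ?_
    simp only [Finset.sum_const, Finset.card_univ, Fintype.card_fin, nsmul_eq_mul]
    have h2 : ((m + 1 : ℕ) : ℝ) ≤ 2 ^ m := by
      exact_mod_cast Nat.succ_le_of_lt Nat.lt_two_pow_self
    calc _ ≤ 2 ^ m * (K * r ^ (m + 1) * M ^ (m + 1) * ‖u‖) :=
          mul_le_mul_of_nonneg_right h2 (by positivity)
      _ = _ := by rw [mul_pow, mul_pow]; ring
  have hrad : 0 < q.radius := by
    have hpos : 0 < 2 * r * M := by positivity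
    have : ((Real.toNNReal (2 * r * M)⁻¹ : NNReal) : ℝ≥0∞) ≤ q.radius := by
      refine q.le_radius_of_bound (K * r * M * ‖u‖) fun m => ?_
      rw [Real.coe_toNNReal _ (by positivity)]
      have := mul_le_mul_of_nonneg_right (hq m) (show 0 ≤ ((2 * r * M)⁻¹) ^ m by positivity)
      refine this.trans (le_of_eq ?_)
      rw [mul_assoc, ← mul_pow, mul_inv_cancel₀ hpos.ne', one_pow, mul_one]
    refine lt_of_lt_of_le ?_ this
    rw [ENNReal.coe_pos, Real.toNNReal_pos]
    positivity
  refine ⟨q.sum, (q.hasFPowerSeriesOnBall hrad).analyticAt, ?_⟩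
  have htel : ∀ m z, p (m + 1) (fun _ => z) - p (m + 1) (fun _ => P z)
      = l z * q m (fun _ => z) := by
    intro m z
    let T : ℕ → ℂ := fun j => p (m + 1) (fun i => if (i : ℕ) < j then z else P z)
    have hT : ∀ j : Fin (m + 1), T (j + 1) - T j = l z * c m j (fun _ => z) := by
      intro j
      have e1 : (fun i : Fin (m + 1) => if (i : ℕ) < (j : ℕ) + 1 then z else P z)
          = Function.update (fun i : Fin (m + 1) => if (i : ℕ) < j then z else P z) j z := by
        funext i
        by_cases h : i = j
        · subst h; simp
        · have : (i : ℕ) ≠ j := fun h' => h (Fin.ext h')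
          rw [Function.update_of_ne h]
          have : (i : ℕ) < j + 1 ↔ (i : ℕ) < j := by omega
          simp [this]
      have e2 : (fun i : Fin (m + 1) => if (i : ℕ) < (j : ℕ) then z else P z)
          = Function.update (fun i : Fin (m + 1) => if (i : ℕ) < j then z else P z) j (P z) := by
        rw [eq_comm, Function.update_eq_self_iff]; simp
      have e3 : c m j (fun _ => z) = p (m + 1)
          (Function.update (fun i : Fin (m + 1) => if (i : ℕ) < j then z else P z) j u) := by
        simp only [c, ContinuousMultilinearMap.curryMid_apply,
          ContinuousMultilinearMap.compContinuousLinearMap_apply]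
        congr 1
        funext i
        by_cases h : i = j
        · subst h; simp [A]
        · obtain ⟨i', rfl⟩ := Fin.exists_succAbove_eq h
          rw [Function.update_of_ne h, Fin.insertNth_apply_succAbove]
          have hne : ((j.succAbove i' : Fin (m+1)) : ℕ) ≠ j := fun h' => h (Fin.ext h')
          by_cases hlt : ((j.succAbove i' : Fin (m+1)) : ℕ) < j
          · have : j.succAbove i' ≤ j := Fin.le_def.2 hlt.le
            simp only [A, this, hlt, if_true]; rfl
          · have : ¬ j.succAbove i' ≤ j := fun h' => by
              have := Fin.le_def.1 h'; omega
            simp only [A, this, hlt, if_false]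
      have e4 : z - P z = l z • u := by rw [hPz]; abel
      simp only [T]
      rw [e1, e3]
      conv_lhs => rw [e2]
      rw [Function.update_idem, ← ContinuousMultilinearMap.map_update_sub, e4,
        ContinuousMultilinearMap.map_update_smul, smul_eq_mul]
    have hsum : ∑ j : Fin (m + 1), (T (j + 1) - T j) = T (m + 1) - T 0 := by
      rw [Fin.sum_univ_eq_sum_range (fun j => T (j + 1) - T j) (m + 1), Finset.sum_range_sub]
    have hT0 : T 0 = p (m + 1) (fun _ => P z) := by simp [T]
    have hT1 : T (m + 1) = p (m + 1) (fun _ => z) := by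
      simp only [T]
      congr 1
      funext i
      simp [i.2]
    rw [← hT1, ← hT0, ← hsum]
    simp only [q, _root_.sum_apply, Finset.mul_sum]
    exact Finset.sum_congr rfl fun j _ => hT j
  have h1 : ∀ᶠ z in 𝓝 (0 : E), HasSum (fun m => p m fun _ => z) (g z) := by
    simpa using hp.eventually_hasSum
  have hPt : Tendsto P (𝓝 0) (𝓝 0) := by simpa using P.continuous.tendsto 0
  have h3 : ∀ᶠ z in 𝓝 (0 : E), HasSum (fun m => q m fun _ => z) (q.sum z) := by
    simpa using (q.hasFPowerSeriesOnBall hrad).hasFPowerSeriesAt.eventually_hasSum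
  filter_upwards [h1, hPt.eventually h1, h3] with z hz1 hz2 hz3
  have hs := hz1.sub hz2
  rw [← hasSum_nat_add_iff' 1] at hs
  simp only [htel] at hs
  have h0 : (p 0 fun _ => z) = p 0 fun _ => P z := by congr 1; funext i; exact i.elim0
  have := hs.unique (hz3.mul_left (l z))
  rw [← this, ← hPz]
  simp [h0]

/-! ### Algebra of alternating maps -/

/-- Alternating `k`-forms on `ℂⁿ`. -/
abbrev Alt (n k : ℕ) : Type := AlternatingMap ℂ (Cn n) ℂ (Fin k)

/-- The forms annihilated by contraction with `x`. -/
def killer {n : ℕ} (k : ℕ) (x : Cn n) : Submodule ℂ (Alt n k) where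
  carrier := {a | ∀ (v : Fin k → Cn n) (i : Fin k), v i = x → a v = 0}
  add_mem' := by
    intro a b ha hb v i h
    simp [ha v i h, hb v i h]
  zero_mem' := by intro v i h; simp
  smul_mem' := by
    intro c a ha v i h
    simp [ha v i h]

/-- Exterior product with a covector. -/
def wd {n k : ℕ} (l : Cn n →ₗ[ℂ] ℂ) (a : Alt n k) : Alt n (k + 1) :=
  AlternatingMap.alternatizeUncurryFin (l.smulRight a)

theorem wd_apply {n k : ℕ} (l : Cn n →ₗ[ℂ] ℂ) (a : Alt n k) (v : Fin (k + 1) → Cn n) :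
    wd l a v = ∑ i : Fin (k + 1), (-1 : ℂ) ^ (i : ℕ) * (l (v i) * a (i.removeNth v)) := by
  simp only [wd, AlternatingMap.alternatizeUncurryFin_apply]
  refine Finset.sum_congr rfl fun i _ => ?_
  simp only [LinearMap.smulRight_apply, AlternatingMap.smul_apply, smul_eq_mul]
  rcases Nat.even_or_odd (i : ℕ) with h | h <;> simp [h.neg_one_pow]

theorem killer_iff {n k : ℕ} (x : Cn n) (a : Alt n (k + 1)) :
    a ∈ killer (k + 1) x ↔ a.curryLeft x = 0 := by
  constructor
  · intro h
    ext v
    exact h _ 0 rfl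
  · intro h v i hv
    have h1 := a.map_insertNth i (v i) (i.removeNth v)
    rw [Fin.insertNth_self_removeNth] at h1
    rw [h1, hv]
    have h2 : a (Matrix.vecCons x (i.removeNth v)) = 0 := by
      rw [← AlternatingMap.curryLeft_apply_apply, h]; rfl
    rw [h2, smul_zero]

theorem killer_curry {n k : ℕ} (x y : Cn n) (a : Alt n (k + 1)) (h : a ∈ killer (k + 1) x) :
    a.curryLeft y ∈ killer k x := by
  intro v i hv
  exact h (Matrix.vecCons y v) i.succ (by simpa using hv)

theorem killer_curry_self {n k : ℕ} (x : Cn n) (a : Alt n (k + 1)) :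
    a.curryLeft x ∈ killer k x := by
  intro v i hv
  rw [AlternatingMap.curryLeft_apply_apply]
  exact a.map_eq_zero_of_eq _ (i := 0) (j := i.succ) (by simpa using hv.symm)
    (Fin.succ_ne_zero i).symm

theorem curry_wd {n k : ℕ} (l : Cn n →ₗ[ℂ] ℂ) (x : Cn n) (a : Alt n (k + 1)) :
    (wd l a).curryLeft x = l x • a - wd l (a.curryLeft x) := by
  ext v
  rw [AlternatingMap.curryLeft_apply_apply, wd_apply, Fin.sum_univ_succ]
  simp only [AlternatingMap.sub_apply, AlternatingMap.smul_apply, wd_apply, smul_eq_mul]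
  rw [sub_eq_add_neg, ← Finset.sum_neg_distrib]
  congr 1
  · simp [Fin.removeNth_zero]
  · refine Finset.sum_congr rfl fun i _ => ?_
    have : i.succ.removeNth (Matrix.vecCons x v : Fin (k + 2) → Cn n)
        = Matrix.vecCons x (i.removeNth v) := by
      funext j
      refine Fin.cases ?_ (fun j => ?_) j
      · simp [Fin.removeNth]
      · simp [Fin.removeNth]
    rw [this, AlternatingMap.curryLeft_apply_apply]
    simp [pow_succ]

theorem curry_wd_killer {n k : ℕ} (l : Cn n →ₗ[ℂ] ℂ) (x : Cn n) (a : Alt n k)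
    (h : a ∈ killer k x) : (wd l a).curryLeft x = l x • a := by
  cases k with
  | zero =>
    ext v
    rw [AlternatingMap.curryLeft_apply_apply, wd_apply]
    simp
  | succ k =>
    rw [curry_wd, (killer_iff x a).1 h]
    have : wd l (0 : Alt n k) = 0 := by ext v; simp [wd_apply]
    rw [this, sub_zero]

theorem wd_add {n k : ℕ} (l : Cn n →ₗ[ℂ] ℂ) (a b : Alt n k) : wd l (a + b) = wd l a + wd l b := by
  ext v; simp [wd_apply, mul_add, Finset.sum_add_distrib]

theorem wd_killer {n k : ℕ} (l : Cn n →ₗ[ℂ] ℂ) (x : Cn n) (a : Alt n k)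
    (h : a ∈ killer k x) (hl : l x = 0) : wd l a ∈ killer (k + 1) x := by
  rw [killer_iff, curry_wd_killer l x a h, hl, zero_smul]

instance finite_alt (n k : ℕ) : Module.Finite ℂ (Alt n k) := by
  let F : Alt n k →ₗ[ℂ] ((Fin k → Fin n) → ℂ) :=
    { toFun := fun a v => a (fun i => Pi.basisFun ℂ (Fin n) (v i))
      map_add' := fun a b => by funext v; simp
      map_smul' := fun a b => by funext v; simp }
  refine Module.Finite.of_injective F ?_
  intro a b hab
  refine Module.Basis.ext_alternating (Pi.basisFun ℂ (Fin n)) fun v _ => ?_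
  exact congrFun hab v

/-! ### Holomorphic forms -/

theorem hol_add {n k : ℕ} {c : Cn n} {a b : Form n k} (ha : HolFormAt c a) (hb : HolFormAt c b) :
    HolFormAt c (fun z => a z + b z) := fun v => by
  simpa using (ha v).fun_add (hb v)

theorem hol_sub {n k : ℕ} {c : Cn n} {a b : Form n k} (ha : HolFormAt c a) (hb : HolFormAt c b) :
    HolFormAt c (fun z => a z - b z) := fun v => by
  simpa using (ha v).fun_sub (hb v)

theorem hol_wd {n k : ℕ} {c : Cn n} {a : Form n k} (l : Cn n →ₗ[ℂ] ℂ) (ha : HolFormAt c a) :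
    HolFormAt c (fun z => wd l (a z)) := fun v => by
  simp only [wd_apply]
  refine Finset.analyticAt_fun_sum _ fun i _ => ?_
  exact analyticAt_const.fun_mul (analyticAt_const.fun_mul (ha _))

theorem hol_smul {n k : ℕ} {c : Cn n} {a : Form n k} {f : Cn n → ℂ} (hf : AnalyticAt ℂ f c)
    (ha : HolFormAt c a) : HolFormAt c (fun z => f z • a z) := fun v => by
  simpa using hf.fun_mul (ha v)

theorem alt_sum_apply {n k : ℕ} {ι : Type*} (s : Finset ι) (f : ι → Alt n k)
    (v : Fin k → Cn n) : (∑ i ∈ s, f i) v = ∑ i ∈ s, f i v := by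
  classical
  induction s using Finset.induction_on with
  | empty => simp
  | insert a s ha ih => rw [Finset.sum_insert ha, Finset.sum_insert ha, AlternatingMap.add_apply, ih]

theorem hol_curry {n k : ℕ} {c : Cn n} {a : Form n (k + 1)} {X : VF n} (hX : AnalyticAt ℂ X c)
    (ha : HolFormAt c a) : HolFormAt c (fun z => (a z).curryLeft (X z)) := fun v => by
  have hXi : ∀ i, AnalyticAt ℂ (fun z => X z i) c := fun i =>
    ((ContinuousLinearMap.proj (R := ℂ) (φ := fun _ : Fin n => ℂ) i).analyticAt (X c)).comp hX
  have : (fun z => (a z).curryLeft (X z) v)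
      = fun z => ∑ i, X z i * (a z) (Matrix.vecCons (Pi.basisFun ℂ (Fin n) i) v) := by
    funext z
    conv_lhs => rw [← (Pi.basisFun ℂ (Fin n)).sum_repr (X z)]
    rw [map_sum, alt_sum_apply]
    refine Finset.sum_congr rfl fun i _ => ?_
    rw [map_smul, AlternatingMap.smul_apply, AlternatingMap.curryLeft_apply_apply]
    simp
  rw [this]
  exact Finset.analyticAt_fun_sum _ fun i _ => (hXi i).fun_mul (ha _)

theorem hol_comp {n k : ℕ} {c : Cn n} {a : Form n k} {f : VF n} (hf : AnalyticAt ℂ f c)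
    (ha : HolFormAt (f c) a) : HolFormAt c (fun z => a (f z)) := fun v => by
  exact AnalyticAt.comp (g := fun z => a z v) (ha v) hf

/-- Linear functionals of holomorphic forms are holomorphic. -/
theorem hol_dual {n k : ℕ} {c : Cn n} (N : Submodule ℂ (Alt n k)) (a : Cn n → N)
    (ha : HolFormAt c (fun z => (a z : Alt n k))) (φ : Module.Dual ℂ N) :
    AnalyticAt ℂ (fun z => φ (a z)) c := by
  let ev : (Fin k → Cn n) → Module.Dual ℂ N := fun v =>
    { toFun := fun x => (x : Alt n k) v
      map_add' := fun x y => by simp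
      map_smul' := fun x y => by simp }
  let W : Subspace ℂ (Module.Dual ℂ N) := Submodule.span ℂ (Set.range ev)
  have hW : Submodule.dualCoannihilator W = ⊥ := by
    rw [eq_bot_iff]
    intro x hx
    rw [Submodule.mem_dualCoannihilator] at hx
    rw [Submodule.mem_bot]
    ext v
    exact hx (ev v) (Submodule.subset_span ⟨v, rfl⟩)
  have hW2 : W = ⊤ := by
    rw [← Subspace.dualCoannihilator_dualAnnihilator_eq (W := W), hW, Submodule.dualAnnihilator_bot]
  have hφ : φ ∈ W := by rw [hW2]; trivial
  refine Submodule.span_induction (p := fun φ _ => AnalyticAt ℂ (fun z => φ (a z)) c)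
    ?_ ?_ ?_ ?_ hφ
  · rintro _ ⟨v, rfl⟩
    exact ha v
  · exact analyticAt_const
  · intro x y _ _ hx hy
    exact hx.fun_add hy
  · intro t x _ hx
    exact analyticAt_const.fun_mul hx

theorem exists_div_form {n k : ℕ} (N : Submodule ℂ (Alt n k)) (η : Form n k)
    (hη : HolFormAt 0 η) (hN : ∀ z, η z ∈ N) (l : Cn n →L[ℂ] ℂ) (u : Cn n) :
    ∃ γ : Form n k, HolFormAt 0 γ ∧ (∀ z, γ z ∈ N) ∧
      ∀ᶠ z in 𝓝 (0 : Cn n), η z - η (z - l z • u) = l z • γ z := by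
  let B := Module.finBasis ℂ N
  let a : Cn n → N := fun z => ⟨η z, hN z⟩
  have h1 := fun i => exists_div (fun z => B.coord i (a z)) (hol_dual N a hη _) l u
  choose h hh heq using h1
  refine ⟨fun z => ((∑ i, h i z • B i : N) : Alt n k), ?_, fun z => Subtype.property _, ?_⟩
  · intro v
    have : (fun z => ((∑ i, h i z • B i : N) : Alt n k) v)
        = fun z => ∑ i, h i z * (B i : Alt n k) v := by
      funext z
      simp [alt_sum_apply]
    rw [this]
    exact Finset.analyticAt_fun_sum _ fun i _ => (hh i).fun_mul analyticAt_const
  · filter_upwards [eventually_all.2 heq] with z hz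
    have : a z - a (z - l z • u) = l z • ∑ i, h i z • B i := by
      apply B.repr.injective
      ext i
      have := hz i
      simp only [Module.Basis.coord_apply] at this
      simp [Finsupp.single_apply, this]
    exact congrArg Subtype.val this

theorem vanish_scalar {n : ℕ} (S : Submodule ℂ (Cn n)) (l : Cn n →L[ℂ] ℂ) (u : Cn n) (hu : u ∈ S)
    (hlu : l u = 1) (g : Cn n → ℂ) (hg : AnalyticAt ℂ g 0)
    (h : ∀ᶠ z in 𝓝[S] (0 : Cn n), l z * g z = 0) : ∀ᶠ z in 𝓝[S] (0 : Cn n), g z = 0 := by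
  rw [eventually_nhdsWithin_iff] at h ⊢
  have hc := hg.eventually_analyticAt
  filter_upwards [(h.and hc).eventually_nhds] with z hz hzS
  by_cases hl : l z = 0
  · have hcont : ContinuousAt (fun t : ℂ => g (z + t • u)) 0 := by
      have h1 : ContinuousAt g (z + (0 : ℂ) • u) := by
        simpa using hz.self_of_nhds.2.continuousAt
      exact ContinuousAt.comp (f := fun t : ℂ => z + t • u) h1 (by fun_prop)
    have ht : Tendsto (fun t : ℂ => z + t • u) (𝓝 0) (𝓝 z) := by
      have : ContinuousAt (fun t : ℂ => z + t • u) 0 := by fun_prop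
      simpa [ContinuousAt] using this
    have hev : ∀ᶠ t in 𝓝[≠] (0 : ℂ), g (z + t • u) = 0 := by
      rw [eventually_nhdsWithin_iff]
      filter_upwards [ht.eventually hz] with t ht ht0
      have := ht.1 (S.add_mem hzS (S.smul_mem t hu))
      rw [map_add, map_smul, hl, hlu] at this
      simpa [show t ≠ 0 from ht0] using this
    have hlim : Tendsto (fun t : ℂ => g (z + t • u)) (𝓝[≠] 0) (𝓝 (g z)) := by
      have := hcont.tendsto.mono_left (nhdsWithin_le_nhds (s := {0}ᶜ))
      simpa using this
    exact tendsto_nhds_unique (hlim.congr' hev) tendsto_const_nhds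
  · have := hz.self_of_nhds.1 hzS
    simpa [hl] using this

theorem vanish_form {n k : ℕ} (S : Submodule ℂ (Cn n)) (l : Cn n →L[ℂ] ℂ) (u : Cn n) (hu : u ∈ S)
    (hlu : l u = 1) (δ : Form n k) (hδ : HolFormAt 0 δ)
    (h : ∀ᶠ z in 𝓝[S] (0 : Cn n), l z • δ z = 0) : ∀ᶠ z in 𝓝[S] (0 : Cn n), δ z = 0 := by
  have h1 : ∀ v : Fin k → Fin n, ∀ᶠ z in 𝓝[S] (0 : Cn n),
      δ z (fun i => Pi.basisFun ℂ (Fin n) (v i)) = 0 := by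
    intro v
    refine vanish_scalar S l u hu hlu _ (hδ _) ?_
    filter_upwards [h] with z hz
    have := congrArg (fun a : Alt n k => a (fun i => Pi.basisFun ℂ (Fin n) (v i))) hz
    simpa using this
  filter_upwards [eventually_all.2 h1] with z hz
  refine Module.Basis.ext_alternating (Pi.basisFun ℂ (Fin n)) fun v _ => ?_
  simpa using hz v

/-! ### The induction -/

/-- The slice `λ_i = 0` for `i < s`. -/
def slice {n r : ℕ} (lam : Fin r → (Cn n →L[ℂ] ℂ)) (s : ℕ) : Submodule ℂ (Cn n) where
  carrier := {z | ∀ i : Fin r, (i : ℕ) < s → lam i z = 0}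
  add_mem' := by
    intro a b ha hb i hi
    simp [ha i hi, hb i hi]
  zero_mem' := by intro i _; simp
  smul_mem' := by
    intro c a ha i hi
    simp [ha i hi]

/-- The forms annihilated by the first `s` vectors. -/
def kills {n r : ℕ} (e : Fin r → Cn n) (s k : ℕ) : Submodule ℂ (Alt n k) where
  carrier := {a | ∀ i : Fin r, (i : ℕ) < s → a ∈ killer k (e i)}
  add_mem' := fun ha hb i hi => Submodule.add_mem _ (ha i hi) (hb i hi)
  zero_mem' := fun _ _ => Submodule.zero_mem _
  smul_mem' := fun c _ ha i hi => Submodule.smul_mem _ c (ha i hi)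

theorem kills_top {n r k : ℕ} {κ : Type*} [Fintype κ] (b : Module.Basis (Fin r ⊕ κ) ℂ (Cn n))
    (hk : n < k + r) (a : Alt n k) (ha : a ∈ kills (fun i => b (Sum.inl i)) r k) : a = 0 := by
  refine Module.Basis.ext_alternating b fun v hv => ?_
  have hcard : r + Fintype.card κ = n := by
    have := Module.finrank_eq_card_basis b
    simpa using this.symm
  by_cases hex : ∃ j i, v j = Sum.inl i
  · obtain ⟨j, i, hji⟩ := hex
    rw [AlternatingMap.zero_apply]
    exact ha i i.2 _ j (by rw [hji])
  · exfalso
    push Not at hex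
    have h2 : ∀ j, ∃ c, v j = Sum.inr c := by
      intro j
      rcases hvj : v j with i | c
      · exact absurd hvj (hex j i)
      · exact ⟨c, rfl⟩
    choose w hw using h2
    have hwi : Function.Injective w := by
      intro i j hij
      apply hv
      rw [hw, hw, hij]
    have := Fintype.card_le_of_injective w hwi
    simp at this
    omega

theorem main_induction {n r : ℕ} {κ : Type*} [Fintype κ]
    (b : Module.Basis (Fin r ⊕ κ) ℂ (Cn n))
    (Y : VF n) (hY : AnalyticAt ℂ Y 0) (lam : Fin r → (Cn n →L[ℂ] ℂ)) (u : Fin r → Cn n)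
    (hlu : ∀ i j, lam i (u j) = if i = j then 1 else 0)
    (hYl : ∀ᶠ z in 𝓝 (0 : Cn n), ∀ i, b.coord (Sum.inl i) (Y z) = lam i z) (d : ℕ) :
    ∀ s : ℕ, s + d = r → ∀ k : ℕ, n < k + r → ∀ ω : Form n k, HolFormAt 0 ω →
      (∀ z, ω z ∈ kills (fun i => b (Sum.inl i)) s k) →
      (∀ᶠ z in 𝓝[slice lam s] (0 : Cn n), ω z ∈ killer k (Y z)) →
      ∃ β : Form n (k + 1), HolFormAt 0 β ∧
        (∀ z, β z ∈ kills (fun i => b (Sum.inl i)) s (k + 1)) ∧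
        ∀ᶠ z in 𝓝[slice lam s] (0 : Cn n), ω z = (β z).curryLeft (Y z) := by
  induction d with
  | zero =>
    intro s hs k hk ω hω hωk hωY
    refine ⟨fun _ => 0, fun v => analyticAt_const, fun z => Submodule.zero_mem _, ?_⟩
    refine Eventually.of_forall fun z => ?_
    obtain rfl : s = r := by omega
    rw [kills_top b hk (ω z) (hωk z)]
    simp
  | succ d ih =>
    intro s hs k hk ω hω hωk hωY
    have hsr : s < r := by omega
    have hrn : r ≤ n := by
      have := Module.finrank_eq_card_basis b
      simp at this
      omega
    obtain ⟨m, rfl⟩ : ∃ m, k = m + 1 := ⟨k - 1, by omega⟩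
    let σ : Fin r := ⟨s, hsr⟩
    set e : Cn n := b (Sum.inl σ) with he
    set l : Cn n →ₗ[ℂ] ℂ := b.coord (Sum.inl σ) with hl
    have hle : l e = 1 := by simp [hl, he]
    have hlei : ∀ i : Fin r, (i : ℕ) < s → l (b (Sum.inl i)) = 0 := by
      intro i hi
      have : i ≠ σ := fun h => by simp [h, σ] at hi
      simp [hl, Finsupp.single_apply, this]
    let ω1 : Form n m := fun z => (ω z).curryLeft e
    have hω1 : HolFormAt 0 ω1 := hol_curry (X := fun _ => e) analyticAt_const hω
    let ωZ : Form n (m + 1) := fun z => ω z - wd l (ω1 z)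
    have hωZ : HolFormAt 0 ωZ := hol_sub hω (hol_wd l hω1)
    have hωZk : ∀ z, ωZ z ∈ kills (fun i => b (Sum.inl i)) (s + 1) (m + 1) := by
      intro z i hi
      by_cases his : (i : ℕ) < s
      · exact Submodule.sub_mem _ (hωk z i his)
          (wd_killer l _ _ (killer_curry _ _ _ (hωk z i his)) (hlei i his))
      · have : i = σ := Fin.ext (by simp [σ]; omega)
        subst this
        show ωZ z ∈ killer (m + 1) e
        rw [killer_iff]
        show (AlternatingMap.curryLeftLinearMap (ω z - wd l (ω1 z))) e = 0
        rw [map_sub, LinearMap.sub_apply]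
        show (ω z).curryLeft e - (wd l (ω1 z)).curryLeft e = 0
        rw [curry_wd_killer l e _ (killer_curry_self e (ω z)), hle, one_smul, sub_self]
    have hsub : slice lam (s + 1) ≤ slice lam s := fun z hz i hi => hz i (by omega)
    have hωZY : ∀ᶠ z in 𝓝[slice lam (s + 1)] (0 : Cn n), ωZ z ∈ killer (m + 1) (Y z) := by
      filter_upwards [hωY.filter_mono (nhdsWithin_mono _ hsub), self_mem_nhdsWithin,
        hYl.filter_mono nhdsWithin_le_nhds] with z h1 h2 h3
      refine Submodule.sub_mem _ h1 (wd_killer l _ _ (killer_curry _ _ _ h1) ?_)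
      rw [hl, h3 σ]
      exact h2 σ (by simp [σ])
    obtain ⟨βZ, hβZ, hβZk, hβZY⟩ := ih (s + 1) (by omega) (m + 1) hk ωZ hωZ hωZk hωZY
    let η : Form n (m + 1) := fun z => ωZ z - (βZ z).curryLeft (Y z)
    have hη : HolFormAt 0 η := hol_sub hωZ (hol_curry hY hβZ)
    have hηk : ∀ z, η z ∈ kills (fun i => b (Sum.inl i)) (s + 1) (m + 1) := fun z =>
      Submodule.sub_mem _ (hωZk z) fun i hi => killer_curry _ _ _ (hβZk z i hi)
    obtain ⟨γ, hγ, hγk, hγη⟩ := exists_div_form _ η hη hηk (lam σ) (u σ)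
    have hpi : Tendsto (fun z : Cn n => z - lam σ z • u σ) (𝓝[slice lam s] 0)
        (𝓝[slice lam (s + 1)] 0) := by
      refine tendsto_nhdsWithin_iff.2 ⟨?_, ?_⟩
      · have : ContinuousAt (fun z : Cn n => z - lam σ z • u σ) 0 := by fun_prop
        have h2 := this.tendsto
        simp only [map_zero, zero_smul, sub_zero] at h2
        exact h2.mono_left nhdsWithin_le_nhds
      · filter_upwards [self_mem_nhdsWithin] with z hz i hi
        rw [map_sub, map_smul, hlu]
        by_cases his : i = σ
        · subst his; simp
        · have : (i : ℕ) < s := by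
            have : (i : ℕ) ≠ s := fun h => his (Fin.ext h)
            omega
          simp [his, hz i this]
    have hη2 : ∀ᶠ z in 𝓝[slice lam s] (0 : Cn n),
        ωZ z = (βZ z).curryLeft (Y z) + lam σ z • γ z := by
      filter_upwards [hpi.eventually hβZY, hγη.filter_mono nhdsWithin_le_nhds] with z h1 h2
      have h3 : η (z - lam σ z • u σ) = 0 := by simp only [η]; rw [h1, sub_self]
      rw [h3, sub_zero] at h2
      rw [← h2]
      simp [η]
    let δ : Form n m := fun z => ω1 z + (γ z).curryLeft (Y z)
    have hδ : HolFormAt 0 δ := hol_add hω1 (hol_curry hY hγ)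
    let β : Form n (m + 2) := fun z => βZ z + wd l (γ z)
    have hβ : HolFormAt 0 β := hol_add hβZ (hol_wd l hγ)
    have hkey : ∀ᶠ z in 𝓝[slice lam s] (0 : Cn n),
        ω z = (β z).curryLeft (Y z) + wd l (δ z) := by
      filter_upwards [hη2, hYl.filter_mono nhdsWithin_le_nhds] with z h1 h2
      have e1 : ω z = ωZ z + wd l (ω1 z) := by simp [ωZ]
      have e2 : (β z).curryLeft (Y z) = (βZ z).curryLeft (Y z) + (wd l (γ z)).curryLeft (Y z) := by
        simp only [β, AlternatingMap.curryLeft_add, LinearMap.add_apply]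
      rw [e1, h1, e2, curry_wd, hl, h2 σ]
      simp only [δ, wd_add]
      abel
    have hδ0 : ∀ᶠ z in 𝓝[slice lam s] (0 : Cn n), δ z = 0 := by
      refine vanish_form (slice lam s) (lam σ) (u σ) ?_ (by simp [hlu]) δ hδ ?_
      · intro i hi
        have : i ≠ σ := fun h => by simp [h, σ] at hi
        simp [hlu, this]
      · filter_upwards [hkey, hωY, hYl.filter_mono nhdsWithin_le_nhds] with z h1 h2 h3
        have h4 : wd l (δ z) ∈ killer (m + 1) (Y z) := by
          have : wd l (δ z) = ω z - (β z).curryLeft (Y z) := by rw [h1]; simp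
          rw [this]
          exact Submodule.sub_mem _ h2 (killer_curry_self _ _)
        have h5 : δ z ∈ killer m (Y z) :=
          Submodule.add_mem _ (killer_curry _ _ _ h2) (killer_curry_self _ _)
        rw [killer_iff, curry_wd_killer l _ _ h5, hl, h3 σ] at h4
        exact h4
    refine ⟨β, hβ, ?_, ?_⟩
    · intro z i hi
      exact Submodule.add_mem _ (hβZk z i (by omega))
        (wd_killer l _ _ (hγk z i (by omega)) (hlei i hi))
    · filter_upwards [hkey, hδ0] with z h1 h2
      rw [h1, h2]
      have : wd l (0 : Alt n m) = 0 := by ext v; simp [wd_apply]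
      rw [this, add_zero]


/-- The non-singular case. -/
theorem divides_of_ne {n k : ℕ} (X : VF n) (hX : AnalyticAt ℂ X 0) (hX0 : X 0 ≠ 0)
    (α : Form n k) (hα : HolFormAt 0 α)
    (hcon : ∀ᶠ z in 𝓝 (0 : Cn n), α z ∈ killer k (X z)) :
    ∃ β : Form n (k + 1), HolFormAt 0 β ∧
      ∀ᶠ z in 𝓝 (0 : Cn n), α z = (β z).curryLeft (X z) := by
  obtain ⟨i, hi⟩ : ∃ i, X 0 i ≠ 0 := by
    by_contra h
    push Not at h
    exact hX0 (funext h)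
  have hXi : AnalyticAt ℂ (fun z => X z i) 0 :=
    ((ContinuousLinearMap.proj (R := ℂ) (φ := fun _ : Fin n => ℂ) i).analyticAt (X 0)).comp hX
  let l : Cn n →ₗ[ℂ] ℂ := LinearMap.proj i
  refine ⟨fun z => (X z i)⁻¹ • wd l (α z), hol_smul (hXi.fun_inv hi) (hol_wd l hα), ?_⟩
  filter_upwards [hcon, hXi.continuousAt.eventually_ne hi] with z h1 h2
  rw [AlternatingMap.curryLeft_smul, LinearMap.smul_apply, curry_wd_killer l _ _ h1, smul_smul]
  simp [l, h2]

theorem divides_of_eq {n r k : ℕ} (X : VF n) (hX : AnalyticAt ℂ X 0) (hX0 : X 0 = 0)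
    (hrk : r ≤ rkAt X 0) (hk : n < k + r)
    (α : Form n k) (hα : HolFormAt 0 α)
    (hcon : ∀ᶠ z in 𝓝 (0 : Cn n), α z ∈ killer k (X z)) :
    ∃ β : Form n (k + 1), HolFormAt 0 β ∧
      ∀ᶠ z in 𝓝 (0 : Cn n), α z = (β z).curryLeft (X z) := by
  set D := fderiv ℂ X 0 with hD
  obtain ⟨f, hf⟩ := exists_linearIndependent_of_le_finrank hrk
  have hf' : LinearIndependent ℂ (fun i => (f i : Cn n)) :=
    hf.map' (Submodule.subtype _) (Submodule.ker_subtype _)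
  have hu : ∀ i, ∃ x, D x = (f i : Cn n) := fun i => (f i).2
  choose u hu using hu
  let b := Module.Basis.sumExtend hf'
  have hb : ∀ i, b (Sum.inl i) = (f i : Cn n) := fun i => by
    simp [b, Module.Basis.sumExtend, Trans.trans]
    erw [Equiv.symm_symm, Equiv.trans_apply]
    rfl
  have : Finite (Fin r ⊕ Module.Basis.sumExtendIndex hf') := Module.Finite.finite_basis b
  have : Finite (Module.Basis.sumExtendIndex hf') := Finite.sum_right (Fin r)
  have : Fintype (Module.Basis.sumExtendIndex hf') := Fintype.ofFinite _
  let co : Fin r → (Cn n →L[ℂ] ℂ) := fun i => LinearMap.toContinuousLinearMap (b.coord (Sum.inl i))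
  have hco : ∀ i x, co i x = b.coord (Sum.inl i) x := fun i x => rfl
  let lam : Fin r → (Cn n →L[ℂ] ℂ) := fun i => (co i).comp D
  have hlu : ∀ i j, lam i (u j) = if i = j then 1 else 0 := by
    intro i j
    simp only [lam, ContinuousLinearMap.comp_apply, hu, hco]
    rw [← hb j]
    simp [Finsupp.single_apply, eq_comm]
  let φ : VF n := fun z => z + ∑ j, (co j (X z) - lam j z) • u j
  have hcoX : ∀ j, AnalyticAt ℂ (fun z => co j (X z)) 0 := fun j =>
    ((co j).analyticAt (X 0)).comp hX
  have hφ : AnalyticAt ℂ φ 0 :=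
    analyticAt_id.fun_add (Finset.analyticAt_fun_sum _ fun j _ =>
      ((hcoX j).fun_sub ((lam j).analyticAt 0)).fun_smul analyticAt_const)
  have hφ0 : φ 0 = 0 := by simp [φ, hX0]
  have hφd : HasFDerivAt φ (ContinuousLinearMap.id ℂ (Cn n)) 0 := by
    have h1 : ∀ j, HasFDerivAt (fun z => (co j (X z) - lam j z) • u j)
        ((0 : Cn n →L[ℂ] ℂ).smulRight (u j)) 0 := by
      intro j
      have h2 : HasFDerivAt (fun z => co j (X z) - lam j z) (0 : Cn n →L[ℂ] ℂ) 0 := by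
        have h3 : HasFDerivAt (fun z => co j (X z)) ((co j).comp D) 0 :=
          (co j).hasFDerivAt.comp 0 hX.differentiableAt.hasFDerivAt
        simpa [lam] using h3.fun_sub (lam j).hasFDerivAt
      exact h2.smul_const (u j)
    have := (hasFDerivAt_id (𝕜 := ℂ) (0 : Cn n)).fun_add (HasFDerivAt.fun_sum fun j (_ : j ∈ Finset.univ) => h1 j)
    refine this.congr_fderiv ?_
    ext x : 1
    simp
  have hφs : HasStrictFDerivAt φ
      ((ContinuousLinearEquiv.refl ℂ (Cn n) : Cn n ≃L[ℂ] Cn n) : Cn n →L[ℂ] Cn n) 0 := by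
    have := hφ.hasStrictFDerivAt
    rw [hφd.fderiv] at this
    exact this
  let Φ := hφs.toOpenPartialHomeomorph φ
  have hΦ : ∀ z, Φ z = φ z := fun z => by simp [Φ]
  have hsrc : (0 : Cn n) ∈ Φ.source := hφs.mem_toOpenPartialHomeomorph_source
  have hΦc : (Φ : Cn n → Cn n) = φ := funext hΦ
  let ψ : VF n := Φ.symm
  have hψ : AnalyticAt ℂ ψ 0 := by
    have := Φ.analyticAt_symm' (i := ContinuousLinearEquiv.refl ℂ (Cn n)) hsrc
      (by rw [hΦc]; exact hφ) (by rw [hΦc, hφd.fderiv]; rfl)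
    rwa [hΦ, hφ0] at this
  have hψ0 : ψ 0 = 0 := by
    have := Φ.left_inv hsrc
    rwa [hΦ, hφ0] at this
  have hright : ∀ᶠ w in 𝓝 (0 : Cn n), φ (ψ w) = w := by
    have h0 : (0 : Cn n) ∈ Φ.target := by
      have := Φ.map_source hsrc
      rwa [hΦ, hφ0] at this
    filter_upwards [Φ.open_target.mem_nhds h0] with w hw
    rw [← hΦ]; exact Φ.right_inv hw
  have hleft : ∀ᶠ z in 𝓝 (0 : Cn n), ψ (φ z) = z := by
    filter_upwards [Φ.open_source.mem_nhds hsrc] with z hz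
    rw [← hΦ]; exact Φ.left_inv hz
  have hlamφ : ∀ i z, lam i (φ z) = co i (X z) := by
    intro i z
    simp [φ, hlu]
  have hψt : Tendsto ψ (𝓝 0) (𝓝 0) := by simpa [hψ0] using hψ.continuousAt.tendsto
  have hφt : Tendsto φ (𝓝 0) (𝓝 0) := by simpa [hφ0] using hφ.continuousAt.tendsto
  obtain ⟨β, hβ, -, hβY⟩ := main_induction b (fun w => X (ψ w))
    (AnalyticAt.comp (g := X) (by rw [hψ0]; exact hX) hψ) lam u hlu
    (by
      filter_upwards [hright] with w hw i
      rw [← hco, ← hlamφ, hw]) r 0 (by omega) k hk (fun w => α (ψ w))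
    (hol_comp hψ (by rw [hψ0]; exact hα))
    (fun z i hi => absurd hi (Nat.not_lt_zero _))
    ((hψt.eventually hcon).filter_mono nhdsWithin_le_nhds)
  have hS : ((slice lam 0 : Submodule ℂ (Cn n)) : Set (Cn n)) = Set.univ := by
    ext z
    simp only [Set.mem_univ, iff_true]
    exact fun i hi => absurd hi (Nat.not_lt_zero _)
  rw [hS, nhdsWithin_univ] at hβY
  refine ⟨fun z => β (φ z), hol_comp hφ (by rw [hφ0]; exact hβ), ?_⟩
  filter_upwards [hφt.eventually hβY, hleft] with z h1 h2
  simpa [h2] using h1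

end DivAux

/-- Proposition 5.6: Let `X` be a germ of holomorphic vector field at
`0 ∈ ℂⁿ` with `rank (DX 0) ≥ p + 1`. Then `X` satisfies the division property by
`k`-forms for `n - p ≤ k ≤ n - 1`: every germ of holomorphic `k`-form `α` with
`i_X α = 0` can be written `α = i_X β` for a germ of holomorphic `(k+1)`-form `β`. -/
theorem statement_17 (n p : ℕ) (X : VF n) (hX : AnalyticAt ℂ X 0)
    (hrk : p + 1 ≤ rkAt X 0) (k : ℕ) (hk1 : n - p ≤ k) (hk2 : k ≤ n - 1)
    (α : Form n k) (hα : HolFormAt 0 α)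
    (hcon : ∀ᶠ z in 𝓝 (0 : Cn n), TangentAt α X z) :
    DividesAt X α 0 := by
  have hcon' : ∀ᶠ z in 𝓝 (0 : Cn n), α z ∈ DivAux.killer k (X z) := hcon
  obtain ⟨β, hβ, h⟩ : ∃ β : Form n (k + 1), HolFormAt 0 β ∧
      ∀ᶠ z in 𝓝 (0 : Cn n), α z = (β z).curryLeft (X z) := by
    by_cases hX0 : X 0 = 0
    · exact DivAux.divides_of_eq X hX hX0 hrk (by omega) α hα hcon'
    · exact DivAux.divides_of_ne X hX hX0 α hα hcon'
  refine ⟨β, hβ, ?_⟩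
  filter_upwards [h] with z hz v
  rw [hz]
  rfl
end
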